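/- Stable orbit equivalence preserves free indecomposability: if two p.m.p. countable Borel equivalence relations R and S on standard probability spaces are stably orbit equivalent, then R is freely indecomposable if and only if S is freely indecomposable. In particular, if Y is a non-null Borel complete section of R, then R is freely indecomposable if and only if R|Y is freely indecomposable. -/

import Mathlib

open MeasureTheory

/-- A countable Borel equivalence relation on `X`, defined on a Borel domain `dom`:
it is Borel as a subset of `X × X`, is an equivalence relation on `dom`, and has
countable classes. -/
structure CBER (X : Type) [MeasurableSpace X] where
  dom : Set X
  dom_meas : MeasurableSet dom
  rel : X → X → Prop
  rel_meas : MeasurableSet {p : X × X | rel p.1 p.2}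
  rel_dom : ∀ {x y : X}, rel x y → x ∈ dom ∧ y ∈ dom
  refl : ∀ x ∈ dom, rel x x
  symm : ∀ {x y : X}, rel x y → rel y x
  trans : ∀ {x y z : X}, rel x y → rel y z → rel x z
  countable_classes : ∀ x : X, {y | rel x y}.Countable

/-- The class of `x`. -/
def CBER.cls {X : Type} [MeasurableSpace X] (R : CBER X) (x : X) : Set X := {y | R.rel x y}

/-- The `R`-saturation of a set `A`: the union of the `R`-classes meeting `A`. -/
def CBER.sat {X : Type} [MeasurableSpace X] (R : CBER X) (A : Set X) : Set X :=
  {y | ∃ x ∈ A, R.rel x y}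

/-- A complete section: a Borel subset of the domain meeting every class. -/
def CBER.IsCompleteSection {X : Type} [MeasurableSpace X] (R : CBER X) (A : Set X) : Prop :=
  MeasurableSet A ∧ A ⊆ R.dom ∧ ∀ x ∈ R.dom, ∃ y ∈ A, R.rel x y

/-- A smooth CBER: one admitting a Borel fundamental domain (a Borel set meeting
every class exactly once). -/
def CBER.Smooth {X : Type} [MeasurableSpace X] (R : CBER X) : Prop :=
  ∃ D : Set X, MeasurableSet D ∧ D ⊆ R.dom ∧ ∀ x ∈ R.dom, ∃! y, y ∈ D ∧ R.rel x y

/-- Smoothness of the restriction `R|A`. -/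
def CBER.SmoothOn {X : Type} [MeasurableSpace X] (R : CBER X) (A : Set X) : Prop :=
  ∃ D : Set X, MeasurableSet D ∧ D ⊆ A ∧ ∀ x ∈ R.dom ∩ A, ∃! y, y ∈ D ∧ R.rel x y

/-- All classes are finite. -/
def CBER.FiniteClasses {X : Type} [MeasurableSpace X] (R : CBER X) : Prop :=
  ∀ x ∈ R.dom, (R.cls x).Finite

/-- Aperiodic: all classes are infinite (on the domain). -/
def CBER.Aperiodic {X : Type} [MeasurableSpace X] (R : CBER X) : Prop :=
  ∀ x ∈ R.dom, (R.cls x).Infinite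

/-- Trivial: all classes are singletons. -/
def CBER.TrivialClasses {X : Type} [MeasurableSpace X] (R : CBER X) : Prop :=
  ∀ x y, R.rel x y → x = y

/-- The restriction `R|U` of `R` to a Borel set `U`. -/
def CBER.restrict {X : Type} [MeasurableSpace X] (R : CBER X) (U : Set X)
    (hU : MeasurableSet U) : CBER X where
  dom := R.dom ∩ U
  dom_meas := R.dom_meas.inter hU
  rel x y := R.rel x y ∧ x ∈ U ∧ y ∈ U
  rel_meas := by
    have h : {p : X × X | R.rel p.1 p.2 ∧ p.1 ∈ U ∧ p.2 ∈ U} =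
        {p : X × X | R.rel p.1 p.2} ∩ (Prod.fst ⁻¹' U ∩ Prod.snd ⁻¹' U) := by
      ext p
      simp only [Set.mem_setOf_eq, Set.mem_inter_iff, Set.mem_preimage, and_assoc]
    rw [h]
    exact R.rel_meas.inter ((measurable_fst hU).inter (measurable_snd hU))
  rel_dom := fun h => ⟨⟨(R.rel_dom h.1).1, h.2.1⟩, ⟨(R.rel_dom h.1).2, h.2.2⟩⟩
  refl := fun x hx => ⟨R.refl x hx.1, hx.2, hx.2⟩
  symm := fun h => ⟨R.symm h.1, h.2.2, h.2.1⟩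
  trans := fun h h' => ⟨R.trans h.1 h'.1, h.2.1, h'.2.2⟩
  countable_classes := fun x =>
    Set.Countable.mono (fun y hy => hy.1) (R.countable_classes x)

/-- `S` is a subrelation of `R`. -/
def CBER.IsSubrelOf {X : Type} [MeasurableSpace X] (S R : CBER X) : Prop :=
  S.dom ⊆ R.dom ∧ ∀ x y, S.rel x y → R.rel x y

/-- A partial Borel isomorphism between Borel subsets `src` and `tgt` of `X`. -/
structure PBI (X : Type) [MeasurableSpace X] where
  src : Set X
  tgt : Set X
  src_meas : MeasurableSet src
  tgt_meas : MeasurableSet tgt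
  toFun : X → X
  invFun : X → X
  meas_toFun : Measurable toFun
  meas_invFun : Measurable invFun
  mapsTo : Set.MapsTo toFun src tgt
  mapsTo_inv : Set.MapsTo invFun tgt src
  left_inv : ∀ x ∈ src, invFun (toFun x) = x
  right_inv : ∀ y ∈ tgt, toFun (invFun y) = y

/-- Membership in the full pseudogroup `[[R]]`: a partial Borel isomorphism whose
graph is contained in `R`. -/
def CBER.InPseudogroup {X : Type} [MeasurableSpace X] (R : CBER X) (φ : PBI X) : Prop :=
  φ.src ⊆ R.dom ∧ ∀ x ∈ φ.src, R.rel x (φ.toFun x)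

/-- Two subrelations `S₁`, `S₂` of `R` are inner conjugate in `R` if some element of the
full pseudogroup of `R` with domain `D(S₂)` and target `D(S₁)` conjugates one to the other. -/
def InnerConjugate {X : Type} [MeasurableSpace X] (R S₁ S₂ : CBER X) : Prop :=
  ∃ φ : PBI X, R.InPseudogroup φ ∧ φ.src = S₂.dom ∧ φ.tgt = S₁.dom ∧
    ∀ x ∈ φ.src, ∀ y ∈ φ.src, (S₂.rel x y ↔ S₁.rel (φ.toFun x) (φ.toFun y))

/-- `R` preserves the measure `μ`: every element of its full pseudogroup preserves `μ`. -/
def CBER.IsPMP {X : Type} [MeasurableSpace X] (R : CBER X) (μ : Measure X) : Prop :=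
  ∀ φ : PBI X, R.InPseudogroup φ → ∀ A : Set X, A ⊆ φ.src → MeasurableSet A →
    μ (φ.toFun '' A) = μ A

/-- Free independence of a family of equivalence relations: any cycle alternating
nontrivially among the factors must have two consecutive steps in the same factor. -/
def FreelyIndep {X : Type} [MeasurableSpace X] {ι : Type} (Rf : ι → CBER X) : Prop :=
  ∀ (n : ℕ) (x : ℕ → X) (i : ℕ → ι), 2 ≤ n → x n = x 0 →
    (∀ j < n, x j ≠ x (j + 1)) → (∀ j < n, (Rf (i j)).rel (x j) (x (j + 1))) →
    ∃ j, j + 1 < n ∧ i j = i (j + 1)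

/-- `R` is the free product of the family `Rf`: the family is freely independent and `R`
is the smallest equivalence relation on the union of the domains containing every `Rf i`. -/
def IsFreeProduct {X : Type} [MeasurableSpace X] {ι : Type} (R : CBER X)
    (Rf : ι → CBER X) : Prop :=
  FreelyIndep Rf ∧ R.dom = (⋃ i, (Rf i).dom) ∧
    ∀ x y, R.rel x y ↔
      (x ∈ R.dom ∧ Relation.EqvGen (fun a b => ∃ i, (Rf i).rel a b) x y)

/-- The partition `U = ⊔ⱼ Uⱼ` trivializes the free product decomposition `R = *ⱼ Rf j`:
`U` is a complete section for `R`, the partition is `R|U`-invariant, and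
`R|Uⱼ = (Rf j)|Uⱼ` for every `j`. -/
def Trivializes {X : Type} [MeasurableSpace X] {ι : Type}
    (R : CBER X) (Rf : ι → CBER X) (U : ι → Set X) : Prop :=
  (∀ j, MeasurableSet (U j)) ∧ (∀ j, U j ⊆ R.dom) ∧
  Pairwise (Function.onFun Disjoint U) ∧
  (∀ x ∈ R.dom, ∃ y ∈ ⋃ j, U j, R.rel x y) ∧
  (∀ i j : ι, ∀ x ∈ U i, ∀ y ∈ U j, R.rel x y → i = j) ∧
  (∀ j, ∀ x ∈ U j, ∀ y ∈ U j, (R.rel x y ↔ (Rf j).rel x y))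

/-- A free product decomposition is inessential if it admits a trivialization. -/
def Inessential {X : Type} [MeasurableSpace X] {ι : Type}
    (R : CBER X) (Rf : ι → CBER X) : Prop :=
  ∃ U : ι → Set X, Trivializes R Rf U

/-- Freely indecomposable (Borel context): every free product decomposition is inessential. -/
def FreelyIndecomposable {X : Type} [MeasurableSpace X] (R : CBER X) : Prop :=
  ∀ (ι : Type) (_ : Countable ι) (Rf : ι → CBER X), IsFreeProduct R Rf → Inessential R Rf

/-- Inessential decomposition in the measured context: a trivialization up to `μ`-null sets. -/
def InessentialMod {X : Type} [MeasurableSpace X] (μ : Measure X) {ι : Type}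
    (R : CBER X) (Rf : ι → CBER X) : Prop :=
  ∃ (U : ι → Set X) (C : Set X),
    (∀ j, MeasurableSet (U j)) ∧ (∀ j, U j ⊆ R.dom) ∧
    Pairwise (Function.onFun Disjoint U) ∧
    MeasurableSet C ∧ μ Cᶜ = 0 ∧
    (∀ x ∈ R.dom ∩ C, ∃ y ∈ ⋃ j, U j, R.rel x y) ∧
    (∀ i j : ι, ∀ x ∈ U i ∩ C, ∀ y ∈ U j ∩ C, R.rel x y → i = j) ∧
    (∀ j, ∀ x ∈ U j ∩ C, ∀ y ∈ U j ∩ C, (R.rel x y ↔ (Rf j).rel x y))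

/-- Freely indecomposable (measured context): every free product decomposition is
inessential up to `μ`-null sets. -/
def FreelyIndecomposableMod {X : Type} [MeasurableSpace X] (μ : Measure X)
    (R : CBER X) : Prop :=
  ∀ (ι : Type) (_ : Countable ι) (Rf : ι → CBER X), IsFreeProduct R Rf →
    InessentialMod μ R Rf

/-- One step of a word in a graphing: apply `φ` (if `e = true`) or `φ⁻¹` (if `e = false`). -/
def PBIStep {X : Type} [MeasurableSpace X] (φ : PBI X) : Bool → X → X → Prop
  | true, a, b => a ∈ φ.src ∧ φ.toFun a = b
  | false, a, b => a ∈ φ.tgt ∧ φ.invFun a = b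

/-- A treeing: any cyclic word in the generators and their inverses admits a reduction. -/
def IsTreeing {X : Type} [MeasurableSpace X] {ι : Type} (Φ : ι → PBI X) : Prop :=
  ∀ (n : ℕ) (i : ℕ → ι) (ε : ℕ → Bool) (x : ℕ → X),
    0 < n → x n = x 0 → (∀ j < n, PBIStep (Φ (i j)) (ε j) (x j) (x (j + 1))) →
    ∃ j, j + 1 < n ∧ i j = i (j + 1) ∧ ε j ≠ ε (j + 1)

/-- The graphing `Φ` generates `R`: `R` is the smallest equivalence relation on the union of
the sources and targets containing the graphs of the `Φ i`. -/
def GeneratesCBER {X : Type} [MeasurableSpace X] {ι : Type} (Φ : ι → PBI X)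
    (R : CBER X) : Prop :=
  R.dom = (⋃ i, ((Φ i).src ∪ (Φ i).tgt)) ∧ (∀ i, R.InPseudogroup (Φ i)) ∧
    ∀ x y, R.rel x y ↔ (x ∈ R.dom ∧
      Relation.EqvGen (fun a b => ∃ i, a ∈ (Φ i).src ∧ (Φ i).toFun a = b) x y)

/-- Treeable: generated by some (countable) treeing. -/
def CBER.Treeable {X : Type} [MeasurableSpace X] (R : CBER X) : Prop :=
  ∃ Φ : ℕ → PBI X, IsTreeing Φ ∧ GeneratesCBER Φ R

/-- Hyperfinite: increasing union of finite Borel subrelations. -/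
def CBER.Hyperfinite {X : Type} [MeasurableSpace X] (R : CBER X) : Prop :=
  ∃ S : ℕ → CBER X, (∀ n, (S n).IsSubrelOf R) ∧ (∀ n, (S n).FiniteClasses) ∧
    (∀ n, (S n).dom = R.dom) ∧ (∀ n, ∀ x y, (S n).rel x y → (S (n + 1)).rel x y) ∧
    ∀ x y, R.rel x y → ∃ n, (S n).rel x y

/-- Ergodicity of a measured CBER: every invariant Borel set is null or conull. -/
def ErgodicCBER {X : Type} [MeasurableSpace X] (R : CBER X) (μ : Measure X) : Prop :=
  ∀ A : Set X, MeasurableSet A → (∀ x ∈ A, ∀ y, R.rel x y → y ∈ A) →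
    μ A = 0 ∨ μ Aᶜ = 0

/-- A stable orbit equivalence between measured CBERs: a Borel isomorphism between
complete sections (mod null sets), sending the normalized measure to the normalized
measure, and preserving the relations a.e. -/
structure SOEquiv {X Y : Type} [MeasurableSpace X] [MeasurableSpace Y]
    (R : CBER X) (μ : Measure X) (S : CBER Y) (ν : Measure Y) where
  A : Set X
  B : Set Y
  toFun : X → Y
  invFun : Y → X
  measA : MeasurableSet A
  measB : MeasurableSet B
  A_sub : A ⊆ R.dom
  B_sub : B ⊆ S.dom
  A_pos : 0 < μ A
  B_pos : 0 < ν B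
  A_section : ∀ᵐ x ∂μ, x ∈ R.dom → ∃ y ∈ A, R.rel x y
  B_section : ∀ᵐ y ∂ν, y ∈ S.dom → ∃ z ∈ B, S.rel y z
  meas_toFun : Measurable toFun
  meas_invFun : Measurable invFun
  mapsTo : Set.MapsTo toFun A B
  mapsTo_inv : Set.MapsTo invFun B A
  left_inv : ∀ x ∈ A, invFun (toFun x) = x
  right_inv : ∀ y ∈ B, toFun (invFun y) = y
  measure_eq : ∀ E : Set X, E ⊆ A → MeasurableSet E →
    (μ A)⁻¹ * μ E = (ν B)⁻¹ * ν (toFun '' E)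
  rel_iff : ∃ C : Set X, MeasurableSet C ∧ μ (A \ C) = 0 ∧
    ∀ x ∈ A ∩ C, ∀ y ∈ A ∩ C, (R.rel x y ↔ S.rel (toFun x) (toFun y))

/-- Stable orbit equivalence. -/
def SOE {X Y : Type} [MeasurableSpace X] [MeasurableSpace Y]
    (R : CBER X) (μ : Measure X) (S : CBER Y) (ν : Measure Y) : Prop :=
  Nonempty (SOEquiv R μ S ν)

/-- Orbit equivalence: a stable orbit equivalence where one can take the complete
sections to be the full spaces. -/
def OE {X Y : Type} [MeasurableSpace X] [MeasurableSpace Y]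
    (R : CBER X) (μ : Measure X) (S : CBER Y) (ν : Measure Y) : Prop :=
  ∃ E : SOEquiv R μ S ν, E.A = Set.univ ∧ E.B = Set.univ

/-- A probability measure preserving action of a group `G` on a measured space. -/
structure PMPAction (G : Type) [Group G] (X : Type) [MeasurableSpace X]
    (μ : Measure X) where
  act : G → X → X
  act_one : ∀ x, act 1 x = x
  act_mul : ∀ g h x, act (g * h) x = act g (act h x)
  measurePreserving : ∀ g, MeasurePreserving (act g) μ μ

/-- Essential freeness: a.e. point has trivial stabilizer. -/
def PMPAction.IsFree {G X : Type} [Group G] [MeasurableSpace X] {μ : Measure X}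
    (α : PMPAction G X μ) : Prop :=
  ∀ᵐ x ∂μ, ∀ g : G, α.act g x = x → g = 1

/-- `R` is the orbit equivalence relation of the action `α` restricted to the subgroup `H`. -/
def IsOrbitRel {G X : Type} [Group G] [MeasurableSpace X] {μ : Measure X}
    (α : PMPAction G X μ) (H : Subgroup G) (R : CBER X) : Prop :=
  R.dom = Set.univ ∧ ∀ x y, (R.rel x y ↔ ∃ g ∈ H, α.act g x = y)

/-- A countable group is measurably freely indecomposable (MFI) if the orbit equivalence
relation of every free p.m.p. action of it on a standard probability space is freely
indecomposable. -/
def MFI (G : Type) [Group G] [Countable G] : Prop :=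
  ∀ (X : Type) [MeasurableSpace X] [StandardBorelSpace X]
    (μ : Measure X) [IsProbabilityMeasure μ]
    (α : PMPAction G X μ) (R : CBER X),
    α.IsFree → IsOrbitRel α ⊤ R → FreelyIndecomposableMod μ R

/-- `G` is the internal free product of the family of subgroups `H`. -/
def IsFreeProductOf (G : Type) [Group G] {ι : Type} (H : ι → Subgroup G) : Prop :=
  Function.Bijective (Monoid.CoprodI.lift fun i => (H i).subtype)

/-- A Borel fundamental domain for an action, of the coupling kind: meets a.e. orbit,
and meets each orbit at most once mod null. -/
def IsFundamentalDomainFor {G : Type} [Group G] {Ω : Type} [MeasurableSpace Ω]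
    (ν : Measure Ω) (a : G → Ω → Ω) (D : Set Ω) : Prop :=
  MeasurableSet D ∧ (∀ᵐ x ∂ν, ∃ g : G, a g x ∈ D) ∧
    ∀ g : G, g ≠ 1 → ν (D ∩ a g ⁻¹' D) = 0

/-- A measure equivalence coupling between `G` and `H`: a standard σ-finite measure space
with commuting measure-preserving essentially free actions of `G` and `H`, each admitting
a Borel fundamental domain of finite positive measure. -/
structure MECoupling (G : Type) [Group G] (H : Type) [Group H] where
  (Ω : Type)
  [mΩ : MeasurableSpace Ω]
  [sbΩ : StandardBorelSpace Ω]
  (ν : Measure Ω)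
  sigmaFinite : SigmaFinite ν
  aG : G → Ω → Ω
  aH : H → Ω → Ω
  DG : Set Ω
  DH : Set Ω
  aG_one : ∀ x, aG 1 x = x
  aG_mul : ∀ g g' x, aG (g * g') x = aG g (aG g' x)
  aH_one : ∀ x, aH 1 x = x
  aH_mul : ∀ h h' x, aH (h * h') x = aH h (aH h' x)
  comm : ∀ g h x, aG g (aH h x) = aH h (aG g x)
  mp_aG : ∀ g, MeasurePreserving (aG g) ν ν
  mp_aH : ∀ h, MeasurePreserving (aH h) ν ν
  free_aG : ∀ᵐ x ∂ν, ∀ g, aG g x = x → g = 1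
  free_aH : ∀ᵐ x ∂ν, ∀ h, aH h x = x → h = 1
  fund_DG : IsFundamentalDomainFor ν aG DG
  fund_DH : IsFundamentalDomainFor ν aH DH
  DG_pos : 0 < ν DG
  DG_fin : ν DG < ⊤
  DH_pos : 0 < ν DH
  DH_fin : ν DH < ⊤

/-- The generalized index (compression constant) of a measure equivalence coupling. -/
noncomputable def MECoupling.index {G : Type} [Group G] {H : Type} [Group H]
    (c : MECoupling G H) : ENNReal :=
  c.ν c.DH / c.ν c.DG

/-- Measure equivalence of countable groups. -/
def MeasureEquivalent (G : Type) [Group G] (H : Type) [Group H] : Prop :=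
  Nonempty (MECoupling G H)

/-- Measure equivalence with a prescribed generalized index. -/
def MEwithIndex (G : Type) [Group G] (H : Type) [Group H] (κ : ENNReal) : Prop :=
  ∃ c : MECoupling G H, c.index = κ

section LusinNovikov

open Set Filter Topology

/-- A set covered by countably many Borel sets on each of which `f` is injective. -/
def SigmaInjective {F X : Type} [MeasurableSpace F] (f : F → X) (E : Set F) : Prop :=
  ∃ D : ℕ → Set F, (∀ n, MeasurableSet (D n) ∧ InjOn f (D n)) ∧ E ⊆ ⋃ n, D n

theorem SigmaInjective.mono {F X : Type} [MeasurableSpace F] {f : F → X} {E E' : Set F}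
    (h : SigmaInjective f E) (hE : E' ⊆ E) : SigmaInjective f E' := by
  obtain ⟨D, hD, hED⟩ := h
  exact ⟨D, hD, hE.trans hED⟩

theorem SigmaInjective.of_injOn {F X : Type} [MeasurableSpace F] {f : F → X} {E : Set F}
    (hE : MeasurableSet E) (hf : InjOn f E) : SigmaInjective f E :=
  ⟨fun _ => E, fun _ => ⟨hE, hf⟩, fun _ hx => mem_iUnion.2 ⟨0, hx⟩⟩

theorem SigmaInjective.iUnion {F X K : Type} [Countable K] [MeasurableSpace F] {f : F → X}
    {E : K → Set F} (h : ∀ k, SigmaInjective f (E k)) : SigmaInjective f (⋃ k, E k) := by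
  choose D hD hED using h
  rcases isEmpty_or_nonempty K with hK | hK
  · exact ⟨fun _ => ∅, fun _ => ⟨MeasurableSet.empty, by simp⟩, by simp⟩
  obtain ⟨e, he⟩ := exists_surjective_nat (K × ℕ)
  refine ⟨fun n => D (e n).1 (e n).2, fun n => hD _ _, ?_⟩
  intro x hx
  obtain ⟨k, hk⟩ := mem_iUnion.1 hx
  obtain ⟨m, hm⟩ := mem_iUnion.1 (hED k hk)
  obtain ⟨n, hn⟩ := he (k, m)
  exact mem_iUnion.2 ⟨n, by rw [hn]; exact hm⟩

theorem SigmaInjective.union {F X : Type} [MeasurableSpace F] {f : F → X} {E E' : Set F}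
    (h : SigmaInjective f E) (h' : SigmaInjective f E') : SigmaInjective f (E ∪ E') := by
  rw [union_eq_iUnion]
  exact SigmaInjective.iUnion fun b => by cases b <;> assumption

/-- The common image of the sets `A j` can be covered by Borel sets `N j` such that `f` is
`SigmaInjective` on the part of `A j` lying above `N j`. -/
def SmallFamily {F X J : Type} [MeasurableSpace F] [MeasurableSpace X] (f : F → X)
    (A : J → Set F) : Prop :=
  ∃ N : J → Set X, (∀ j, MeasurableSet (N j)) ∧ (⋂ j, f '' A j) ⊆ ⋃ j, N j ∧
    ∀ j, SigmaInjective f (A j ∩ f ⁻¹' N j)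

theorem SmallFamily.of_update {F X J K : Type} [TopologicalSpace F] [PolishSpace F]
    [MeasurableSpace F] [BorelSpace F] [TopologicalSpace X] [PolishSpace X] [MeasurableSpace X]
    [BorelSpace X] [Finite J] [DecidableEq J] [Countable K] {f : F → X} (hf : Continuous f)
    {A : J → Set F} (hA : ∀ j, MeasurableSet (A j)) {a b : J} (hab : a ≠ b) (hAab : A a = A b)
    {P Q : K → Set F} (hP : ∀ k, MeasurableSet (P k)) (hQ : ∀ k, MeasurableSet (Q k))
    (hPQ : ∀ y z, y ≠ z → ∃ k, y ∈ P k ∧ z ∈ Q k)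
    (h : ∀ k, SmallFamily f
      (Function.update (Function.update A a (A a ∩ P k)) b (A b ∩ Q k))) :
    SmallFamily f A := by
  choose N hN hcov hthin using h
  have ha : ∀ k, SigmaInjective f (A a ∩ P k ∩ f ⁻¹' N k a) := fun k => by
    simpa [Function.update_of_ne hab] using hthin k a
  have hb : ∀ k, SigmaInjective f (A b ∩ Q k ∩ f ⁻¹' N k b) := fun k => by
    simpa using hthin k b
  have hj : ∀ k j, j ≠ a → j ≠ b → SigmaInjective f (A j ∩ f ⁻¹' N k j) := fun k j h1 h2 => by
    simpa [Function.update_of_ne h1, Function.update_of_ne h2] using hthin k j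
  let M : Set X := ⋃ j : {j // j ≠ a ∧ j ≠ b}, ⋃ k, N k j
  have hM : MeasurableSet M := MeasurableSet.iUnion fun j => MeasurableSet.iUnion fun k => hN k j
  let Z : Set X := (⋂ j, f '' A j) ∩ Mᶜ
  have hfm : Measurable f := hf.measurable
  have hB : ∀ k, MeasurableSet ((A a ∩ P k) \ f ⁻¹' N k a) := fun k =>
    ((hA a).inter (hP k)).diff (hfm (hN k a))
  have hC : ∀ k, MeasurableSet ((A b ∩ Q k) \ f ⁻¹' N k b) := fun k =>
    ((hA b).inter (hQ k)).diff (hfm (hN k b))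
  have inter_an : ∀ s t : Set X, AnalyticSet s → AnalyticSet t → AnalyticSet (s ∩ t) := by
    intro s t hs ht
    rw [inter_eq_iInter]
    exact AnalyticSet.iInter fun b => by cases b <;> assumption
  have : Nonempty J := ⟨a⟩
  have hZ : AnalyticSet Z :=
    inter_an _ _ (AnalyticSet.iInter fun j => (hA j).analyticSet.image_of_continuous hf)
      hM.compl.analyticSet
  have hsep : ∀ k, ∃ u, Z ⊆ u ∧
      Disjoint (f '' ((A a ∩ P k) \ f ⁻¹' N k a) ∩ f '' ((A b ∩ Q k) \ f ⁻¹' N k b)) u ∧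
      MeasurableSet u := by
    intro k
    refine AnalyticSet.measurablySeparable hZ
      (inter_an _ _ ((hB k).analyticSet.image_of_continuous hf)
        ((hC k).analyticSet.image_of_continuous hf)) ?_
    rw [Set.disjoint_left]
    rintro x ⟨hx, hxM⟩ ⟨⟨y, ⟨hy, hyN⟩, rfl⟩, ⟨z, ⟨hz, hzN⟩, hzx⟩⟩
    have hmem : f y ∈ ⋃ j, N k j := by
      apply hcov k
      refine mem_iInter.2 fun j => ?_
      rcases eq_or_ne j b with rfl | hjb
      · simpa using ⟨z, hz, hzx⟩
      rw [Function.update_of_ne hjb]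
      rcases eq_or_ne j a with rfl | hja
      · simpa using ⟨y, hy, rfl⟩
      rw [Function.update_of_ne hja]
      exact mem_iInter.1 hx j
    obtain ⟨j, hjm⟩ := mem_iUnion.1 hmem
    rcases eq_or_ne j b with rfl | hjb
    · exact hzN (by rw [mem_preimage, hzx]; exact hjm)
    rcases eq_or_ne j a with rfl | hja
    · exact hyN hjm
    exact hxM (mem_iUnion.2 ⟨⟨j, hja, hjb⟩, mem_iUnion.2 ⟨k, hjm⟩⟩)
  choose u hZu hdisj hu using hsep
  refine ⟨fun j => if j = a then ⋂ k, u k else if j = b then ∅ else ⋃ k, N k j, ?_, ?_, ?_⟩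
  · intro j
    dsimp only
    split_ifs
    · exact MeasurableSet.iInter hu
    · exact MeasurableSet.empty
    · exact MeasurableSet.iUnion fun k => hN k j
  · intro x hx
    by_cases hxM : x ∈ M
    · obtain ⟨⟨j, hja, hjb⟩, hj'⟩ := mem_iUnion.1 hxM
      exact mem_iUnion.2 ⟨j, by rw [if_neg hja, if_neg hjb]; exact hj'⟩
    · exact mem_iUnion.2 ⟨a, by
        rw [if_pos rfl]; exact mem_iInter.2 fun k => hZu k ⟨hx, hxM⟩⟩
  · intro j
    beta_reduce
    rcases eq_or_ne j a with rfl | hja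
    · rw [if_pos rfl]
      let G1 : Set F := ⋃ k, A j ∩ P k ∩ f ⁻¹' N k j
      let G2 : Set F := ⋃ k, A b ∩ Q k ∩ f ⁻¹' N k b
      have hG1 : MeasurableSet G1 :=
        MeasurableSet.iUnion fun k => ((hA j).inter (hP k)).inter (hfm (hN k j))
      have hG2 : MeasurableSet G2 :=
        MeasurableSet.iUnion fun k => ((hA b).inter (hQ k)).inter (hfm (hN k b))
      have hG : SigmaInjective f ((A j ∩ f ⁻¹' ⋂ k, u k) \ (G1 ∪ G2)) := by
        refine SigmaInjective.of_injOn
          (((hA j).inter (hfm (MeasurableSet.iInter hu))).diff (hG1.union hG2)) ?_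
        rintro y ⟨⟨hyA, hyu⟩, hyG⟩ z ⟨⟨hzA, hzu⟩, hzG⟩ hyz
        by_contra hne
        obtain ⟨k, hyP, hzQ⟩ := hPQ y z hne
        refine Set.disjoint_left.1 (hdisj k) ⟨⟨y, ⟨⟨hyA, hyP⟩, fun hy => ?_⟩, rfl⟩,
          ⟨z, ⟨⟨hAab ▸ hzA, hzQ⟩, fun hz => ?_⟩, hyz.symm⟩⟩ (mem_iInter.1 hyu k)
        · exact hyG (Or.inl (mem_iUnion.2 ⟨k, ⟨hyA, hyP⟩, hy⟩))
        · exact hzG (Or.inr (mem_iUnion.2 ⟨k, ⟨hAab ▸ hzA, hzQ⟩, hz⟩))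
      refine (hG.union ((SigmaInjective.iUnion ha).union (SigmaInjective.iUnion hb))).mono ?_
      intro y hy
      by_cases h' : y ∈ G1 ∪ G2
      · exact Or.inr h'
      · exact Or.inl ⟨hy, h'⟩
    rw [if_neg hja]
    rcases eq_or_ne j b with rfl | hjb
    · rw [if_pos rfl]
      exact SigmaInjective.of_injOn (by simp) (by simp)
    rw [if_neg hjb]
    refine (SigmaInjective.iUnion fun k => hj k j hja hjb).mono ?_
    rintro y ⟨hy, hy'⟩
    obtain ⟨k, hk⟩ := mem_iUnion.1 hy'
    exact mem_iUnion.2 ⟨k, hy, hk⟩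

theorem exists_not_smallFamily_sum {F X J K : Type} [TopologicalSpace F] [PolishSpace F]
    [MeasurableSpace F] [BorelSpace F] [TopologicalSpace X] [PolishSpace X] [MeasurableSpace X]
    [BorelSpace X] [Finite J] [Countable K] {f : F → X} (hf : Continuous f)
    {A : J → Set F} (hA : ∀ j, MeasurableSet (A j))
    {P Q : K → Set F} (hP : ∀ k, MeasurableSet (P k)) (hQ : ∀ k, MeasurableSet (Q k))
    (hPQ : ∀ y z, y ≠ z → ∃ k, y ∈ P k ∧ z ∈ Q k) (h : ¬ SmallFamily f A) :
    ∃ k : J → Option K, (∀ j, (k j).isSome) ∧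
      ¬ SmallFamily f (Sum.elim (fun j => A j ∩ (k j).elim univ P)
        (fun j => A j ∩ (k j).elim univ Q)) := by
  classical
  have := Fintype.ofFinite J
  suffices H : ∀ T : Finset J, ∃ k : J → Option K, (∀ j, (k j).isSome ↔ j ∈ T) ∧
      ¬ SmallFamily f (Sum.elim (fun j => A j ∩ (k j).elim univ P)
        (fun j => A j ∩ (k j).elim univ Q)) by
    obtain ⟨k, hk, hs⟩ := H Finset.univ
    exact ⟨k, fun j => (hk j).2 (Finset.mem_univ j), hs⟩
  intro T
  induction T using Finset.induction_on with
  | empty =>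
    refine ⟨fun _ => none, by simp, fun hs => h ?_⟩
    obtain ⟨N, hN, hcov, hthin⟩ := hs
    refine ⟨fun j => N (Sum.inl j) ∪ N (Sum.inr j), fun j => (hN _).union (hN _), ?_, ?_⟩
    · intro x hx
      have : x ∈ ⋃ j, N j := by
        apply hcov
        refine mem_iInter.2 fun j => ?_
        rcases j with j | j <;> simpa using mem_iInter.1 hx j
      obtain ⟨j | j, hj⟩ := mem_iUnion.1 this
      · exact mem_iUnion.2 ⟨j, Or.inl hj⟩
      · exact mem_iUnion.2 ⟨j, Or.inr hj⟩
    · intro j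
      have h1 := hthin (Sum.inl j)
      have h2 := hthin (Sum.inr j)
      simp only [Sum.elim_inl, Sum.elim_inr, Option.elim_none, inter_univ] at h1 h2
      rw [preimage_union, inter_union_distrib_left]
      exact h1.union h2
  | insert i T hi ih =>
    obtain ⟨k, hk, hs⟩ := ih
    have hki : k i = none := by
      rw [← Option.not_isSome_iff_eq_none, hk]; exact hi
    by_contra hcon
    apply hs
    have hmeas : ∀ (P : K → Set F), (∀ k, MeasurableSet (P k)) → ∀ j,
        MeasurableSet (A j ∩ (k j).elim univ P) := by
      intro P hP j
      refine (hA j).inter ?_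
      cases k j
      · exact MeasurableSet.univ
      · exact hP _
    refine SmallFamily.of_update hf (a := Sum.inl i) (b := Sum.inr i) ?_ (by simp)
      (by simp [hki]) hP hQ hPQ fun l => ?_
    · rintro (j | j)
      · exact hmeas P hP j
      · exact hmeas Q hQ j
    · by_contra hl
      refine hcon ⟨Function.update k i (some l), fun j => ?_, fun hs' => hl ?_⟩
      · rcases eq_or_ne j i with rfl | hj
        · simp
        · simp [hj, hk]
      · convert hs' using 1
        funext j
        rcases j with j | j
        · rcases eq_or_ne j i with rfl | hj
          · rw [Function.update_of_ne (by simp), Function.update_self]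
            simp only [Sum.elim_inl, hki, Option.elim_none, inter_univ, Function.update_self,
              Option.elim_some]
          · rw [Function.update_of_ne (by simp), Function.update_of_ne (by simpa using hj)]
            simp only [Sum.elim_inl, Function.update_of_ne hj]
        · rcases eq_or_ne j i with rfl | hj
          · rw [Function.update_self]
            simp only [Sum.elim_inr, hki, Option.elim_none, inter_univ, Function.update_self,
              Option.elim_some]
          · rw [Function.update_of_ne (by simpa using hj), Function.update_of_ne (by simp)]
            simp only [Sum.elim_inr, Function.update_of_ne hj]

/-- A finite family of Borel sets which is not small, a stage of a Cantor scheme. -/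
structure LargeFamily {F X : Type} [MeasurableSpace F] [MeasurableSpace X] (f : F → X) where
  J : Type
  finite : Finite J
  A : J → Set F
  meas : ∀ j, MeasurableSet (A j)
  large : ¬ SmallFamily f A

theorem LargeFamily.exists_succ {F X : Type} [MetricSpace F] [PolishSpace F]
    [MeasurableSpace F] [BorelSpace F] [TopologicalSpace X] [PolishSpace X] [MeasurableSpace X]
    [BorelSpace X] {f : F → X} (hf : Continuous f) (s : LargeFamily f) {ε : ℝ} (hε : 0 < ε) :
    ∃ A : s.J ⊕ s.J → Set F, (∀ j, MeasurableSet (A j)) ∧ ¬ SmallFamily f A ∧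
      (∀ j, A (Sum.inl j) ⊆ s.A j) ∧ (∀ j, A (Sum.inr j) ⊆ s.A j) ∧
      (∀ j, Disjoint (closure (A (Sum.inl j))) (closure (A (Sum.inr j)))) ∧
      (∀ j, ∀ y ∈ A j, ∀ z ∈ A j, dist y z ≤ ε) := by
  have := s.finite
  have hbc := TopologicalSpace.countable_countableBasis F
  have hb := TopologicalSpace.isBasis_countableBasis F
  let b := TopologicalSpace.countableBasis F
  let K := {p : b × b // Disjoint (closure (p.1 : Set F)) (closure (p.2 : Set F)) ∧
    (∀ y ∈ (p.1 : Set F), ∀ z ∈ (p.1 : Set F), dist y z ≤ ε) ∧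
    (∀ y ∈ (p.2 : Set F), ∀ z ∈ (p.2 : Set F), dist y z ≤ ε)}
  have : Countable b := hbc.to_subtype
  have hball : ∀ (w : F) (U : Set F), U ⊆ Metric.ball w (ε / 2) →
      ∀ y ∈ U, ∀ z ∈ U, dist y z ≤ ε := by
    intro w U hU y hy z hz
    have h1 := Metric.mem_ball.1 (hU hy)
    have h2 := Metric.mem_ball.1 (hU hz)
    have h3 := dist_triangle_right y z w
    linarith
  have hPQ : ∀ y z : F, y ≠ z → ∃ k : K, y ∈ (k.1.1 : Set F) ∧ z ∈ (k.1.2 : Set F) := by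
    intro y z hyz
    obtain ⟨U, hyU, hU, V, hzV, hV, hUV⟩ := exists_open_nhds_disjoint_closure hyz
    obtain ⟨U', hU', hyU', hUU'⟩ := hb.exists_subset_of_mem_open
      (show y ∈ U ∩ Metric.ball y (ε / 2) from ⟨hyU, Metric.mem_ball_self (by positivity)⟩)
      (hU.inter Metric.isOpen_ball)
    obtain ⟨V', hV', hzV', hVV'⟩ := hb.exists_subset_of_mem_open
      (show z ∈ V ∩ Metric.ball z (ε / 2) from ⟨hzV, Metric.mem_ball_self (by positivity)⟩)
      (hV.inter Metric.isOpen_ball)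
    refine ⟨⟨(⟨U', hU'⟩, ⟨V', hV'⟩), ?_, ?_, ?_⟩, hyU', hzV'⟩
    · exact hUV.mono (closure_mono fun w hw => (hUU' hw).1) (closure_mono fun w hw => (hVV' hw).1)
    · exact hball y U' fun w hw => (hUU' hw).2
    · exact hball z V' fun w hw => (hVV' hw).2
  have hPm : ∀ k : K, MeasurableSet (k.1.1 : Set F) := fun k => (hb.isOpen k.1.1.2).measurableSet
  have hQm : ∀ k : K, MeasurableSet (k.1.2 : Set F) := fun k => (hb.isOpen k.1.2.2).measurableSet
  obtain ⟨k, hk, hlarge⟩ := exists_not_smallFamily_sum hf s.meas (K := K) hPm hQm hPQ s.large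
  have hk' : ∀ j, ∃ l, k j = some l := fun j => Option.isSome_iff_exists.1 (hk j)
  choose l hl using hk'
  obtain rfl : k = fun j => some (l j) := funext hl
  refine ⟨_, ?_, hlarge, fun j => inter_subset_left, fun j => inter_subset_left, fun j => ?_, ?_⟩
  · rintro (j | j)
    · exact (s.meas j).inter (hPm _)
    · exact (s.meas j).inter (hQm _)
  · exact (l j).2.1.mono (closure_mono inter_subset_right) (closure_mono inter_subset_right)
  · rintro (j | j) y hy z hz
    · exact (l j).2.2.1 y hy.2 z hz.2
    · exact (l j).2.2.2 y hy.2 z hz.2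

theorem sigmaInjective_univ_of_continuous {F X : Type} [TopologicalSpace F] [PolishSpace F]
    [MeasurableSpace F] [BorelSpace F] [TopologicalSpace X] [PolishSpace X] [MeasurableSpace X]
    [BorelSpace X] {f : F → X} (hf : Continuous f) (hc : ∀ x, (f ⁻¹' {x}).Countable) :
    SigmaInjective f univ := by
  let _ := TopologicalSpace.upgradeIsCompletelyMetrizable F
  by_contra hcon
  have h0 : ¬ SmallFamily f (fun _ : Unit => (univ : Set F)) := by
    rintro ⟨N, -, hcov, hthin⟩
    refine hcon ((hthin ()).mono fun y _ => ⟨trivial, ?_⟩)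
    have := hcov (mem_iInter.2 fun _ => mem_image_of_mem f (mem_univ y))
    obtain ⟨⟨⟩, h⟩ := mem_iUnion.1 this
    exact h
  choose nA hmeas hlarge hinl hinr hdisj hdiam using
    fun (n : ℕ) (s : LargeFamily f) => LargeFamily.exists_succ hf s
      (show (0 : ℝ) < (1 / 2) ^ n by positivity)
  let st : ℕ → LargeFamily f := fun n => Nat.rec
    ⟨Unit, inferInstance, _, fun _ => MeasurableSet.univ, h0⟩
    (fun n s => ⟨s.J ⊕ s.J, by have := s.finite; infer_instance, nA n s, hmeas n s, hlarge n s⟩) n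
  let br : (ℕ → Bool) → (n : ℕ) → (st n).J := fun α n => Nat.rec (motive := fun n => (st n).J) ()
    (fun n j => if α n then Sum.inl j else Sum.inr j) n
  have hbr : ∀ α n, br α (n + 1) = if α n then Sum.inl (br α n) else Sum.inr (br α n) :=
    fun α n => rfl
  have hne : ∀ n, (⋂ j, f '' (st n).A j).Nonempty := by
    intro n
    by_contra h
    refine (st n).large ⟨fun _ => ∅, fun _ => MeasurableSet.empty, ?_, fun j => ?_⟩
    · rw [Set.not_nonempty_iff_eq_empty.1 h]; exact empty_subset _
    · exact SigmaInjective.of_injOn (by simp) (by simp)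
  choose x hx using hne
  have hy : ∀ α n, ∃ y ∈ (st n).A (br α n), f y = x n := fun α n => mem_iInter.1 (hx n) (br α n)
  choose y hyA hyx using hy
  have hsucc : ∀ α n, (st (n + 1)).A (br α (n + 1)) ⊆ (st n).A (br α n) := by
    intro α n
    rw [hbr]
    split_ifs
    · exact hinl n (st n) (br α n)
    · exact hinr n (st n) (br α n)
  have hanti : ∀ α, Antitone fun n => (st n).A (br α n) := fun α => antitone_nat_of_succ_le (hsucc α)
  have hlim : ∀ α, ∃ l, Tendsto (y α) atTop (𝓝 l) := by
    intro α
    have : CauchySeq fun n => y α (n + 1) := by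
      refine cauchySeq_of_le_tendsto_0 (fun n => (1 / 2 : ℝ) ^ n) ?_
        (tendsto_pow_atTop_nhds_zero_of_lt_one (by norm_num) (by norm_num))
      intro n m N hn hm
      exact hdiam N (st N) (br α (N + 1)) _ (hanti α (show N + 1 ≤ n + 1 by omega) (hyA α (n + 1))) _
        (hanti α (show N + 1 ≤ m + 1 by omega) (hyA α (m + 1)))
    obtain ⟨l, hl⟩ := cauchySeq_tendsto_of_complete this
    exact ⟨l, (tendsto_add_atTop_iff_nat 1).1 hl⟩
  choose l hl using hlim
  have hfl : ∀ α β, f (l α) = f (l β) := by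
    intro α β
    have h1 := (hf.tendsto (l α)).comp (hl α)
    have h2 := (hf.tendsto (l β)).comp (hl β)
    have h1' : Tendsto x atTop (𝓝 (f (l α))) := h1.congr fun n => hyx α n
    have h2' : Tendsto x atTop (𝓝 (f (l β))) := h2.congr fun n => hyx β n
    exact tendsto_nhds_unique h1' h2'
  have hcl : ∀ α n, l α ∈ closure ((st n).A (br α n)) := by
    intro α n
    refine mem_closure_of_tendsto (hl α) ?_
    filter_upwards [eventually_ge_atTop n] with m hm
    exact hanti α hm (hyA α m)
  have hinj : Function.Injective l := by
    intro α β hαβ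
    by_contra hne
    have hex : ∃ n, α n ≠ β n := Function.ne_iff.1 hne
    classical
    let n := Nat.find hex
    have hn : α n ≠ β n := Nat.find_spec hex
    have hlt : ∀ m < n, α m = β m := fun m hm => not_not.1 (Nat.find_min hex hm)
    have hbreq : ∀ m ≤ n, br α m = br β m := by
      intro m
      induction m with
      | zero => intro _; rfl
      | succ m ih => intro hm; rw [hbr, hbr, ih (by omega), hlt m (by omega)]
    have h1 := hcl α (n + 1)
    have h2 := hcl β (n + 1)
    rw [hbr] at h1 h2
    rw [← hbreq n le_rfl, ← hαβ] at h2
    have hd := Set.disjoint_left.1 (hdisj n (st n) (br α n))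
    cases hα : α n <;> cases hβ : β n
    · exact hn (hα.trans hβ.symm)
    · rw [hα] at h1; rw [hβ] at h2; exact hd h2 h1
    · rw [hα] at h1; rw [hβ] at h2; exact hd h1 h2
    · exact hn (hα.trans hβ.symm)
  have hcount : (range l).Countable :=
    (hc (f (l fun _ => true))).mono (by rintro _ ⟨α, rfl⟩; exact hfl _ _)
  have : Countable (ℕ → Bool) := by
    have := hcount.to_subtype
    exact (rangeFactorization_injective.2 hinj).countable
  obtain ⟨e, he⟩ := exists_surjective_nat (ℕ → Bool)
  obtain ⟨n, hn⟩ := he fun n => !(e n n)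
  have := congrFun hn n
  simp at this

/-- **Lusin–Novikov**: a countable-to-one Borel map between standard Borel spaces is injective on
each member of some countable Borel cover of its source. -/
theorem sigmaInjective_univ_of_measurable {F X : Type} [MeasurableSpace F] [StandardBorelSpace F]
    [MeasurableSpace X] [StandardBorelSpace X] {f : F → X} (hf : Measurable f)
    (hc : ∀ x, (f ⁻¹' {x}).Countable) : SigmaInjective f univ := by
  let tF := upgradeStandardBorel F
  let tX := upgradeStandardBorel X
  have hF : @BorelSpace F tF.toTopologicalSpace _ := inferInstance
  have hF' : @PolishSpace F tF.toTopologicalSpace := inferInstance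
  obtain ⟨t', ht', hcont, hpol⟩ := hf.exists_continuous
  have hb : @BorelSpace F t' _ := ⟨hF.measurable_eq.trans (borel_eq_borel_of_le hpol hF' ht').symm⟩
  exact @sigmaInjective_univ_of_continuous F X t' hpol _ hb _ _ _ _ f hcont hc

end LusinNovikov

section Enumeration

variable {X : Type} [MeasurableSpace X] [StandardBorelSpace X]

/-- A countable Borel equivalence relation is a countable union of graphs of Borel maps. -/
theorem CBER.exists_enumeration (R : CBER X) :
    ∃ f : ℕ → X → X, (∀ n, Measurable (f n)) ∧ (∀ n, ∀ x ∈ R.dom, R.rel x (f n x)) ∧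
      ∀ x y, R.rel x y → ∃ n, f n x = y := by
  classical
  let P : Set (X × X) := {p | R.rel p.1 p.2}
  have : StandardBorelSpace P := R.rel_meas.standardBorel
  let g : P → X := fun p => p.1.1
  have hg : Measurable g := measurable_fst.comp measurable_subtype_coe
  have hc : ∀ x, (g ⁻¹' {x}).Countable := by
    intro x
    have hinj : Set.InjOn (fun p : P => p.1.2) (g ⁻¹' {x}) := by
      rintro p hp q hq hpq
      exact Subtype.ext (Prod.ext (hp.trans hq.symm) hpq)
    refine Set.MapsTo.countable_of_injOn (t := {y | R.rel x y}) ?_ hinj (R.countable_classes x)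
    rintro ⟨p, hp⟩ rfl
    exact hp
  obtain ⟨D, hD, hcov⟩ := sigmaInjective_univ_of_measurable hg hc
  let f : ℕ → X → X := fun n x => if h : ∃ p ∈ D n, g p = x then h.choose.1.2 else x
  have hf : ∀ n, ∀ p ∈ D n, f n (g p) = p.1.2 := by
    intro n p hp
    have h : ∃ q ∈ D n, g q = g p := ⟨p, hp, rfl⟩
    have : h.choose = p := (hD n).2 h.choose_spec.1 hp h.choose_spec.2
    simp only [f, dif_pos h, this]
  have hf' : ∀ n x, x ∉ g '' D n → f n x = x := fun n x hx => dif_neg hx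
  refine ⟨f, fun n B hB => ?_, fun n x hx => ?_, fun x y hxy => ?_⟩
  · have himg : f n ⁻¹' B = g '' (D n ∩ (fun p : P => p.1.2) ⁻¹' B) ∪ ((g '' D n)ᶜ ∩ B) := by
      ext x
      by_cases hx : x ∈ g '' D n
      · obtain ⟨p, hp, rfl⟩ := hx
        simp only [Set.mem_preimage, hf n p hp]
        constructor
        · exact fun h => Or.inl ⟨p, ⟨hp, h⟩, rfl⟩
        · rintro (⟨q, ⟨hq, hqB⟩, hqp⟩ | ⟨h, -⟩)
          · exact (hD n).2 hq hp hqp ▸ hqB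
          · exact absurd ⟨p, hp, rfl⟩ h
      · rw [Set.mem_preimage, hf' n x hx]
        constructor
        · exact fun h => Or.inr ⟨hx, h⟩
        · rintro (⟨q, ⟨hq, -⟩, rfl⟩ | ⟨-, h⟩)
          · exact absurd ⟨q, hq, rfl⟩ hx
          · exact h
    rw [himg]
    have hsnd : Measurable fun p : P => p.1.2 := measurable_snd.comp measurable_subtype_coe
    exact (((hD n).1.inter (hsnd hB)).image_of_measurable_injOn hg
      ((hD n).2.mono Set.inter_subset_left)).union
      (((hD n).1.image_of_measurable_injOn hg (hD n).2).compl.inter hB)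
  · by_cases h : x ∈ g '' D n
    · obtain ⟨p, hp, rfl⟩ := h
      rw [hf n p hp]
      exact p.2
    · rw [hf' n x h]
      exact R.refl x hx
  · obtain ⟨n, hn⟩ := Set.mem_iUnion.1 (hcov (Set.mem_univ (⟨(x, y), hxy⟩ : P)))
    exact ⟨n, hf n _ hn⟩

/-- The points equivalent to some point of `B`. -/
def CBER.hull {X : Type} [MeasurableSpace X] (R : CBER X) (B : Set X) : Set X :=
  {x | ∃ y ∈ B, R.rel x y}

theorem CBER.measurableSet_hull (R : CBER X) {B : Set X} (hB : MeasurableSet B) :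
    MeasurableSet (R.hull B) := by
  obtain ⟨f, hf, hrel, hex⟩ := R.exists_enumeration
  have : R.hull B = ⋃ n, R.dom ∩ f n ⁻¹' B := by
    ext x
    simp only [Set.mem_iUnion, CBER.hull]
    constructor
    · rintro ⟨y, hy, hxy⟩
      obtain ⟨n, rfl⟩ := hex x y hxy
      exact ⟨n, (R.rel_dom hxy).1, hy⟩
    · rintro ⟨n, hx, hn⟩
      exact ⟨_, hn, hrel n x hx⟩
  rw [this]
  exact MeasurableSet.iUnion fun n => R.dom_meas.inter (hf n hB)

theorem CBER.exists_selector (R : CBER X) {B : Set X} (hB : MeasurableSet B) :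
    ∃ s : X → X, Measurable s ∧ (∀ x ∈ R.hull B, s x ∈ B ∧ R.rel x (s x)) ∧
      (∀ x ∉ R.hull B, s x = x) ∧ ∀ x ∈ B, s x = x := by
  classical
  obtain ⟨f, hf, hrel, hex⟩ := R.exists_enumeration
  let g : ℕ → X → X := fun n => Nat.casesOn n id f
  have hg : ∀ n, Measurable (g n) := by
    rintro (_ | n)
    · exact measurable_id
    · exact hf n
  let p : ℕ → X → Prop := fun n x => x ∈ (R.hull B)ᶜ ∪ g n ⁻¹' B
  have hp : ∀ x, ∃ n, p n x := by
    intro x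
    by_cases hx : x ∈ R.hull B
    · obtain ⟨y, hy, hxy⟩ := hx
      obtain ⟨n, rfl⟩ := hex x y hxy
      exact ⟨n + 1, Or.inr hy⟩
    · exact ⟨0, Or.inl hx⟩
  have hzero : ∀ x, p 0 x → g (Nat.find (hp x)) x = x := by
    intro x hx
    rw [(Nat.find_eq_zero (hp x)).2 hx]
    rfl
  have hpm : ∀ n, MeasurableSet {x | p n x} := fun n =>
    (R.measurableSet_hull hB).compl.union (hg n hB)
  refine ⟨fun x => g (Nat.find (hp x)) x, Measurable.find (p := p) hg hpm hp, fun x hx => ?_,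
    fun x hx => hzero x (Or.inl hx), fun x hx => hzero x (Or.inr hx)⟩
  have hdom : x ∈ R.dom := by
    obtain ⟨y, -, hxy⟩ := hx
    exact (R.rel_dom hxy).1
  refine ⟨(Nat.find_spec (hp x)).resolve_left (fun h => h hx), ?_⟩
  change R.rel x (g (Nat.find (hp x)) x)
  generalize Nat.find (hp x) = n
  cases n
  · exact R.refl x hdom
  · exact hrel _ x hdom

/-- Saturations of Borel null sets are null. -/
def CBER.NullInvariant {X : Type} [MeasurableSpace X] (R : CBER X) (μ : Measure X) : Prop :=
  ∀ N, MeasurableSet N → μ N = 0 → μ (R.hull N) = 0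

theorem CBER.IsPMP.nullInvariant {R : CBER X} {μ : Measure X} (h : R.IsPMP μ) :
    R.NullInvariant μ := by
  intro N hN hN0
  obtain ⟨f, hf, hrel, hex⟩ := R.exists_enumeration
  let A : ℕ → ℕ → Set X := fun n m => (R.dom ∩ N) ∩ {x | f m (f n x) = x}
  have hA : ∀ n m, MeasurableSet (A n m) := fun n m =>
    (R.dom_meas.inter hN).inter (measurableSet_eq_fun ((hf m).comp (hf n)) measurable_id)
  have hinj : ∀ n m, Set.InjOn (f n) (A n m) := by
    intro n m x hx y hy hxy
    rw [← hx.2, ← hy.2, hxy]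
  have hsub : R.hull N ⊆ ⋃ n, ⋃ m, f n '' A n m := by
    rintro x ⟨y, hy, hxy⟩
    obtain ⟨n, hn⟩ := hex y x (R.symm hxy)
    obtain ⟨m, hm⟩ := hex x y hxy
    exact Set.mem_iUnion.2 ⟨n, Set.mem_iUnion.2
      ⟨m, y, ⟨⟨(R.rel_dom hxy).2, hy⟩, by rw [Set.mem_ofPred_eq, hn, hm]⟩, hn⟩⟩
  refine measure_mono_null hsub (measure_iUnion_null fun n => measure_iUnion_null fun m => ?_)
  let φ : PBI X :=
    { src := A n m
      tgt := f n '' A n m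
      src_meas := hA n m
      tgt_meas := (hA n m).image_of_measurable_injOn (hf n) (hinj n m)
      toFun := f n
      invFun := f m
      meas_toFun := hf n
      meas_invFun := hf m
      mapsTo := Set.mapsTo_image _ _
      mapsTo_inv := by
        rintro _ ⟨x, hx, rfl⟩
        rw [hx.2]
        exact hx
      left_inv := fun x hx => hx.2
      right_inv := by
        rintro _ ⟨x, hx, rfl⟩
        rw [hx.2] }
  have := h φ ⟨fun x hx => hx.1.1, fun x hx => hrel n x hx.1.1⟩ (A n m) subset_rfl (hA n m)
  rw [show φ.toFun = f n from rfl] at this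
  rw [this]
  exact measure_mono_null (fun x hx => hx.1.2) hN0

end Enumeration

section FreeProduct

/-- The family `c` consists of `G`-valued cocycles on the relations `Rf i`. -/
def IsCocycleFamily {X ι G : Type} [MeasurableSpace X] [Group G] (Rf : ι → CBER X)
    (c : ι → X → X → G) : Prop :=
  ∀ i x y z, (Rf i).rel x y → (Rf i).rel y z → c i x y * c i y z = c i x z

/-- The cocycle `c` on `R` extends the cocycles `d i` on the relations `Rf i`. -/
def ExtendsCocycles {X ι G : Type} [MeasurableSpace X] [Group G] (R : CBER X) (Rf : ι → CBER X)
    (d : ι → X → X → G) (c : X → X → G) : Prop :=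
  (∀ x y z, R.rel x y → R.rel y z → c x y * c y z = c x z) ∧
    ∀ i x y, (Rf i).rel x y → c x y = d i x y

/-- The products of a cocycle family along paths. -/
inductive PathProduct {X ι G : Type} [MeasurableSpace X] [Group G] (Rf : ι → CBER X)
    (c : ι → X → X → G) : X → X → G → Prop
  | nil (x : X) : PathProduct Rf c x x 1
  | cons {i : ι} {x y z : X} {g : G} : (Rf i).rel x y → PathProduct Rf c y z g →
      PathProduct Rf c x z (c i x y * g)

/-- The products of a cocycle family along nonempty reduced paths, with the first index. -/
inductive ReducedProduct {X ι G : Type} [MeasurableSpace X] [Group G] (Rf : ι → CBER X)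
    (c : ι → X → X → G) : ι → X → X → G → Prop
  | single {i : ι} {x y : X} : (Rf i).rel x y → x ≠ y → ReducedProduct Rf c i x y (c i x y)
  | cons {i j : ι} {x y z : X} {g : G} : (Rf i).rel x y → x ≠ y → i ≠ j →
      ReducedProduct Rf c j y z g → ReducedProduct Rf c i x z (c i x y * g)

variable {X ι G : Type} [MeasurableSpace X] [Group G] {R : CBER X} {Rf : ι → CBER X}
  {c : ι → X → X → G}

theorem IsCocycleFamily.self (hc : IsCocycleFamily Rf c) {i : ι} {x : X} (hx : x ∈ (Rf i).dom) :
    c i x x = 1 := by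
  have := hc i x x x ((Rf i).refl x hx) ((Rf i).refl x hx)
  simpa using this

theorem ReducedProduct.exists_sequence {i : ι} {x z : X} {g : G}
    (h : ReducedProduct Rf c i x z g) :
    ∃ (n : ℕ) (u : ℕ → X) (k : ℕ → ι), 1 ≤ n ∧ u 0 = x ∧ u n = z ∧ k 0 = i ∧
      (∀ j < n, u j ≠ u (j + 1)) ∧ (∀ j < n, (Rf (k j)).rel (u j) (u (j + 1))) ∧
      ∀ j, j + 1 < n → k j ≠ k (j + 1) := by
  induction h with
  | @single i x y hxy hne =>
    refine ⟨1, fun j => if j = 0 then x else y, fun _ => i, le_rfl, rfl, rfl, rfl, ?_, ?_, ?_⟩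
    · intro j hj
      obtain rfl : j = 0 := by omega
      simpa using hne
    · intro j hj
      obtain rfl : j = 0 := by omega
      simpa using hxy
    · intro j hj
      omega
  | @cons i j x y z g hxy hne hij _ ih =>
    obtain ⟨n, u, k, hn, hu0, hun, hk0, hu, hr, hk⟩ := ih
    refine ⟨n + 1, fun m => Nat.casesOn m x u, fun m => Nat.casesOn m i k, by omega, rfl, hun, rfl,
      ?_, ?_, ?_⟩
    · rintro (_ | m) hm
      · simpa [hu0] using hne
      · exact hu m (by omega)
    · rintro (_ | m) hm
      · simpa [hu0] using hxy
      · exact hr m (by omega)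
    · rintro (_ | m) hm
      · simpa [hk0] using hij
      · exact hk m (by omega)

theorem FreelyIndep.not_reducedProduct (hR : FreelyIndep Rf) {i : ι} {x : X} {g : G} :
    ¬ ReducedProduct Rf c i x x g := by
  intro h
  obtain ⟨n, u, k, hn, hu0, hun, -, hu, hr, hk⟩ := h.exists_sequence
  have h2 : 2 ≤ n := by
    by_contra hlt
    obtain rfl : n = 1 := by omega
    exact hu 0 (by omega) (hu0.trans hun.symm)
  obtain ⟨j, hj, hjj⟩ := hR n u k h2 (hun.trans hu0.symm) hu hr
  exact hk j hj hjj

theorem PathProduct.reduce (hc : IsCocycleFamily Rf c) {x z : X} {g : G}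
    (h : PathProduct Rf c x z g) : (x = z ∧ g = 1) ∨ ∃ i, ReducedProduct Rf c i x z g := by
  induction h with
  | nil x => exact Or.inl ⟨rfl, rfl⟩
  | @cons i x y z g hxy _ ih =>
    rcases eq_or_ne x y with rfl | hne
    · rw [hc.self ((Rf i).rel_dom hxy).1, one_mul]
      exact ih
    rcases ih with ⟨rfl, rfl⟩ | ⟨j, hj⟩
    · rw [mul_one]
      exact Or.inr ⟨i, .single hxy hne⟩
    rcases eq_or_ne i j with rfl | hij
    · cases hj with
      | single hyz hyz' =>
        rw [hc i _ _ _ hxy hyz]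
        rcases eq_or_ne x z with rfl | hxz
        · exact Or.inl ⟨rfl, hc.self ((Rf i).rel_dom hxy).1⟩
        · exact Or.inr ⟨i, .single ((Rf i).trans hxy hyz) hxz⟩
      | @cons _ j _ w _ g hyw hyw' hij hwz =>
        rw [← mul_assoc, hc i _ _ _ hxy hyw]
        rcases eq_or_ne x w with rfl | hxw
        · rw [hc.self ((Rf i).rel_dom hxy).1, one_mul]
          exact Or.inr ⟨j, hwz⟩
        · exact Or.inr ⟨i, .cons ((Rf i).trans hxy hyw) hxw hij hwz⟩
    · exact Or.inr ⟨i, .cons hxy hne hij hj⟩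

theorem PathProduct.trans {x y z : X} {g g' : G} (h : PathProduct Rf c x y g)
    (h' : PathProduct Rf c y z g') : PathProduct Rf c x z (g * g') := by
  induction h with
  | nil x => rwa [one_mul]
  | cons hxy _ ih =>
    rw [mul_assoc]
    exact .cons hxy (ih h')

theorem PathProduct.symm (hc : IsCocycleFamily Rf c) {x z : X} {g : G}
    (h : PathProduct Rf c x z g) : PathProduct Rf c z x g⁻¹ := by
  induction h with
  | nil x => rw [inv_one]; exact .nil x
  | @cons i x y z g hxy _ ih =>
    have hyx : c i y x = (c i x y)⁻¹ := by
      rw [eq_inv_iff_mul_eq_one, hc i _ _ _ ((Rf i).symm hxy) hxy,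
        hc.self ((Rf i).rel_dom hxy).2]
    have h1 : PathProduct Rf c y x (c i y x * 1) := .cons ((Rf i).symm hxy) (.nil x)
    rw [mul_one, hyx] at h1
    rw [mul_inv_rev]
    exact ih.trans h1

theorem PathProduct.exists_of_eqvGen (hc : IsCocycleFamily Rf c) {x y : X}
    (h : Relation.EqvGen (fun a b => ∃ i, (Rf i).rel a b) x y) :
    ∃ g, PathProduct Rf c x y g := by
  induction h with
  | rel x y h =>
    obtain ⟨i, hi⟩ := h
    exact ⟨_, .cons hi (.nil y)⟩
  | refl x => exact ⟨1, .nil x⟩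
  | symm x y _ ih =>
    obtain ⟨g, hg⟩ := ih
    exact ⟨_, hg.symm hc⟩
  | trans x y z _ _ ih ih' =>
    obtain ⟨g, hg⟩ := ih
    obtain ⟨g', hg'⟩ := ih'
    exact ⟨_, hg.trans hg'⟩

theorem FreelyIndep.pathProduct_unique (hR : FreelyIndep Rf) (hc : IsCocycleFamily Rf c)
    {x y : X} {g g' : G} (h : PathProduct Rf c x y g) (h' : PathProduct Rf c x y g') :
    g = g' := by
  rcases (h.trans (h'.symm hc)).reduce hc with ⟨-, h1⟩ | ⟨i, hi⟩
  · exact mul_inv_eq_one.1 h1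
  · exact absurd hi hR.not_reducedProduct

/-- Cocycles on the factors of a free product extend to the free product. -/
theorem IsFreeProduct.exists_extends (hR : IsFreeProduct R Rf) (hc : IsCocycleFamily Rf c) :
    ∃ d, ExtendsCocycles R Rf c d := by
  classical
  have hex : ∀ x y, R.rel x y → ∃ g, PathProduct Rf c x y g := fun x y hxy =>
    PathProduct.exists_of_eqvGen hc ((hR.2.2 x y).1 hxy).2
  have hsub : ∀ i x y, (Rf i).rel x y → R.rel x y := fun i x y hxy => (hR.2.2 x y).2
    ⟨by rw [hR.2.1]; exact Set.mem_iUnion.2 ⟨i, ((Rf i).rel_dom hxy).1⟩, .rel _ _ ⟨i, hxy⟩⟩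
  let d : X → X → G := fun x y => if h : R.rel x y then (hex x y h).choose else 1
  have hd : ∀ x y, R.rel x y → PathProduct Rf c x y (d x y) := by
    intro x y h
    simp only [d, dif_pos h]
    exact (hex x y h).choose_spec
  refine ⟨d, fun x y z hxy hyz => ?_, fun i x y hxy => ?_⟩
  · exact hR.1.pathProduct_unique hc ((hd _ _ hxy).trans (hd _ _ hyz)) (hd _ _ (R.trans hxy hyz))
  · have h1 : PathProduct Rf c x y (c i x y * 1) := .cons hxy (.nil y)
    rw [mul_one] at h1
    exact hR.1.pathProduct_unique hc (hd _ _ (hsub i x y hxy)) h1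

/-- The word of the path `u` labelled by `k`, of length `n`, starting at time `j`. -/
def pathWord {X ι : Type} (u : ℕ → X) (k : ℕ → ι) : ℕ → ℕ → List ((ι × X) × Bool)
  | _, 0 => []
  | j, n + 1 => ((k j, u j), false) :: ((k j, u (j + 1)), true) :: pathWord u k (j + 1) n

theorem pathWord_isReduced {X ι : Type} {u : ℕ → X} {k : ℕ → ι} (n j : ℕ)
    (hu : ∀ m, m < j + n → u m ≠ u (m + 1)) (hk : ∀ m, m + 1 < j + n → k m ≠ k (m + 1)) :
    FreeGroup.IsReduced (pathWord u k j n) := by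
  induction n generalizing j with
  | zero => exact FreeGroup.IsReduced.nil
  | succ n ih =>
    have h' := ih (j + 1) (fun m hm => hu m (by omega)) (fun m hm => hk m (by omega))
    rw [pathWord, FreeGroup.isReduced_cons_cons]
    refine ⟨fun h => absurd (Prod.ext_iff.1 h).2 (hu j (by omega)), ?_⟩
    cases n with
    | zero => exact FreeGroup.IsReduced.singleton
    | succ n =>
      rw [pathWord] at h' ⊢
      rw [FreeGroup.isReduced_cons_cons]
      exact ⟨fun h => absurd (Prod.ext_iff.1 h).1 (hk j (by omega)), h'⟩

/-- Free independence follows from the extendability of cocycles. -/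
theorem freelyIndep_of_extends (hsub : ∀ i x y, (Rf i).rel x y → R.rel x y)
    (hext : ∀ (G : Type) [Group G] (c : ι → X → X → G), IsCocycleFamily Rf c →
      ∃ d, ExtendsCocycles R Rf c d) : FreelyIndep Rf := by
  classical
  intro n u k hn hun hu hr
  by_contra hcon
  push Not at hcon
  obtain ⟨d, hd, hd'⟩ := hext (FreeGroup (ι × X))
    (fun i x y => (FreeGroup.of (i, x))⁻¹ * FreeGroup.of (i, y))
    (fun i x y z _ _ => by group)
  have hrel : ∀ m j, j + m ≤ n → 1 ≤ m →
      R.rel (u j) (u (j + m)) ∧ d (u j) (u (j + m)) = FreeGroup.mk (pathWord u k j m) := by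
    intro m
    induction m with
    | zero => intro j _ h; omega
    | succ m ih =>
      intro j hj _
      have h1 := hr j (by omega)
      have h2 : FreeGroup.mk (pathWord u k j (m + 1)) =
          d (u j) (u (j + 1)) * FreeGroup.mk (pathWord u k (j + 1) m) := by
        rw [hd' _ _ _ h1]
        rfl
      rcases Nat.eq_zero_or_pos m with rfl | hm
      · refine ⟨hsub _ _ _ h1, ?_⟩
        rw [h2, pathWord, ← FreeGroup.one_eq_mk, mul_one]
      · obtain ⟨h3, h4⟩ := ih (j + 1) (by omega) hm
        rw [show j + 1 + m = j + (m + 1) by omega] at h3 h4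
        exact ⟨R.trans (hsub _ _ _ h1) h3, by rw [h2, ← hd _ _ _ (hsub _ _ _ h1) h3, h4]⟩
  obtain ⟨h1, h2⟩ := hrel n 0 (by omega) (by omega)
  rw [zero_add, hun] at h1 h2
  have h3 : d (u 0) (u 0) = 1 := by simpa using hd _ _ _ h1 h1
  have hred := pathWord_isReduced (u := u) (k := k) n 0 (fun m hm => hu m (by omega))
    (fun m hm => hcon m (by omega))
  have h4 := FreeGroup.isReduced_iff_reduce_eq.1 hred
  have h5 : FreeGroup.reduce (pathWord u k 0 n) = [] := by
    rw [← FreeGroup.toWord_mk, ← h2, h3, FreeGroup.toWord_one]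
  rw [h4] at h5
  obtain ⟨m, rfl⟩ : ∃ m, n = m + 1 := ⟨n - 1, by omega⟩
  simp [pathWord] at h5

end FreeProduct

section Refinement

variable {X : Type} [MeasurableSpace X]

/-- A countable measurable cover can be made disjoint; points belonging to the same pieces of the
original cover stay in the same piece. -/
theorem exists_disjoint_refinement {ι : Type} [Countable ι] {D : ι → Set X}
    (hD : ∀ i, MeasurableSet (D i)) :
    ∃ D' : ι → Set X, (∀ i, MeasurableSet (D' i)) ∧ (∀ i, D' i ⊆ D i) ∧
      (∀ i j x, x ∈ D' i → x ∈ D' j → i = j) ∧ (∀ i, ∀ x ∈ D i, ∃ j, x ∈ D' j) ∧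
      ∀ x y, (∀ i, x ∈ D i ↔ y ∈ D i) → ∀ i, x ∈ D' i → y ∈ D' i := by
  classical
  obtain ⟨e, he⟩ := exists_injective_nat ι
  refine ⟨fun i => D i \ ⋃ j, ⋃ (_ : e j < e i), D j,
    fun i => (hD i).diff (MeasurableSet.iUnion fun j => MeasurableSet.iUnion fun _ => hD j),
    fun i x hx => hx.1, ?_, ?_, ?_⟩
  · intro i j x hi hj
    simp only [Set.mem_sdiff, Set.mem_iUnion, not_exists] at hi hj
    rcases lt_trichotomy (e i) (e j) with h | h | h
    · exact absurd hi.1 (hj.2 i h)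
    · exact he h
    · exact absurd hj.1 (hi.2 j h)
  · intro i x hx
    have hex : ∃ n, ∃ j, e j = n ∧ x ∈ D j := ⟨e i, i, rfl, hx⟩
    obtain ⟨j, hj, hxj⟩ := Nat.find_spec hex
    refine ⟨j, hxj, ?_⟩
    simp only [Set.mem_iUnion, not_exists]
    intro k hk hxk
    rw [hj] at hk
    exact Nat.find_min hex hk ⟨k, rfl, hxk⟩
  · intro x y hxy i
    simp only [Set.mem_sdiff, Set.mem_iUnion, hxy]
    exact id

end Refinement

theorem eqvGen_map {α β : Type} {p : α → α → Prop} {q : β → β → Prop} {g : α → β}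
    (hg : ∀ a b, p a b → Relation.EqvGen q (g a) (g b)) {x y : α} (h : Relation.EqvGen p x y) :
    Relation.EqvGen q (g x) (g y) := by
  induction h with
  | rel x y h => exact hg x y h
  | refl x => exact .refl _
  | symm x y _ ih => exact .symm _ _ ih
  | trans x y z _ _ ih ih' => exact .trans _ _ _ ih ih'

section Trivialization

variable {X ι : Type} [MeasurableSpace X] {μ : Measure X} {R : CBER X} {Rf : ι → CBER X}

theorem IsFreeProduct.rel_of (h : IsFreeProduct R Rf) {i : ι} {x y : X} (hxy : (Rf i).rel x y) :
    R.rel x y :=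
  (h.2.2 x y).2 ⟨by rw [h.2.1]; exact Set.mem_iUnion.2 ⟨i, ((Rf i).rel_dom hxy).1⟩,
    .rel _ _ ⟨i, hxy⟩⟩

theorem isFreeProduct_of_extends (hsub : ∀ i x y, (Rf i).rel x y → R.rel x y)
    (hdom : ∀ x ∈ R.dom, ∃ i, x ∈ (Rf i).dom)
    (hgen : ∀ x y, R.rel x y → Relation.EqvGen (fun a b => ∃ i, (Rf i).rel a b) x y)
    (hext : ∀ (G : Type) [Group G] (c : ι → X → X → G), IsCocycleFamily Rf c →
      ∃ d, ExtendsCocycles R Rf c d) : IsFreeProduct R Rf := by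
  refine ⟨freelyIndep_of_extends hsub hext, ?_, fun x y => ⟨fun h => ⟨(R.rel_dom h).1, hgen x y h⟩,
    fun h => ?_⟩⟩
  · ext x
    rw [Set.mem_iUnion]
    exact ⟨hdom x, fun ⟨i, hi⟩ => (R.rel_dom (hsub i x x ((Rf i).refl x hi))).1⟩
  · have key : ∀ x y, Relation.EqvGen (fun a b => ∃ i, (Rf i).rel a b) x y →
        x = y ∨ R.rel x y := by
      intro x y h
      induction h with
      | rel x y h => exact Or.inr (hsub _ _ _ h.choose_spec)
      | refl x => exact Or.inl rfl
      | symm x y _ ih => exact ih.imp Eq.symm R.symm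
      | trans x y z _ _ ih ih' =>
        rcases ih with rfl | ih
        · exact ih'
        · rcases ih' with rfl | ih'
          · exact Or.inr ih
          · exact Or.inr (R.trans ih ih')
    rcases key x y h.2 with rfl | h'
    · exact R.refl x h.1
    · exact h'

/-- A trivialization of a decomposition over an invariant conull subset `C` of the domain. -/
structure IsTrivializationOn {X ι : Type} [MeasurableSpace X] (μ : Measure X) (R : CBER X)
    (Rf : ι → CBER X) (U : ι → Set X) (C : Set X) : Prop where
  meas : ∀ j, MeasurableSet (U j)
  meas_base : MeasurableSet C
  base_sub : C ⊆ R.dom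
  null : μ (R.dom \ C) = 0
  invariant : ∀ x y, x ∈ C → R.rel x y → y ∈ C
  sub : ∀ j, U j ⊆ C
  complete : ∀ x ∈ C, ∃ j, ∃ y ∈ U j, R.rel x y
  rel : ∀ i j, ∀ x ∈ U i, ∀ y ∈ U j, R.rel x y → i = j ∧ (Rf i).rel x y

theorem IsTrivializationOn.inessentialMod {U : ι → Set X} {C : Set X}
    (h : IsTrivializationOn μ R Rf U C) (hsub : ∀ i x y, (Rf i).rel x y → R.rel x y) :
    InessentialMod μ R Rf := by
  refine ⟨U, C ∪ R.domᶜ, h.meas, fun j => (h.sub j).trans h.base_sub, ?_,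
    h.meas_base.union R.dom_meas.compl, ?_, ?_, ?_, ?_⟩
  · intro i j hij
    refine Set.disjoint_left.2 fun x hi hj => hij ?_
    exact (h.rel i j x hi x hj (R.refl x (h.base_sub (h.sub i hi)))).1
  · rw [Set.compl_union, compl_compl, Set.inter_comm, ← Set.sdiff_eq]
    exact h.null
  · rintro x ⟨hx, hC | hC⟩
    · obtain ⟨j, y, hy, hxy⟩ := h.complete x hC
      exact ⟨y, Set.mem_iUnion.2 ⟨j, hy⟩, hxy⟩
    · exact absurd hx hC
  · rintro i j x ⟨hx, -⟩ y ⟨hy, -⟩ hxy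
    exact (h.rel i j x hx y hy hxy).1
  · rintro j x ⟨hx, -⟩ y ⟨hy, -⟩
    exact ⟨fun hxy => (h.rel j j x hx y hy hxy).2, hsub j x y⟩

theorem InessentialMod.exists_isTrivializationOn [StandardBorelSpace X] (hμ : R.NullInvariant μ)
    (h : InessentialMod μ R Rf) : ∃ U C, IsTrivializationOn μ R Rf U C := by
  obtain ⟨U, C, hU, hUd, hdisj, hC, hC0, hcomp, hinv, hrel⟩ := h
  have hH := R.measurableSet_hull hC.compl
  have hC' : ∀ x ∈ R.dom \ R.hull Cᶜ, x ∈ C := fun x hx => by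
    by_contra hxC
    exact hx.2 ⟨x, hxC, R.refl x hx.1⟩
  have hinv' : ∀ x y, x ∈ R.dom \ R.hull Cᶜ → R.rel x y → y ∈ R.dom \ R.hull Cᶜ := by
    rintro x y ⟨-, hx⟩ hxy
    exact ⟨(R.rel_dom hxy).2, fun ⟨z, hz, hyz⟩ => hx ⟨z, hz, R.trans hxy hyz⟩⟩
  refine ⟨fun j => U j ∩ (R.dom \ R.hull Cᶜ), R.dom \ R.hull Cᶜ,
    fun j => (hU j).inter (R.dom_meas.diff hH), R.dom_meas.diff hH, fun x hx => hx.1, ?_, hinv',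
    fun j x hx => hx.2, ?_, ?_⟩
  · refine measure_mono_null ?_ (hμ _ hC.compl hC0)
    rintro x ⟨hx, hx'⟩
    by_contra hn
    exact hx' ⟨hx, hn⟩
  · intro x hx
    obtain ⟨y, hy, hxy⟩ := hcomp x ⟨hx.1, hC' x hx⟩
    obtain ⟨j, hj⟩ := Set.mem_iUnion.1 hy
    exact ⟨j, y, ⟨hj, hinv' x y hx hxy⟩, hxy⟩
  · rintro i j x ⟨hx, hxC⟩ y ⟨hy, hyC⟩ hxy
    obtain rfl := hinv i j x ⟨hx, hC' x hxC⟩ y ⟨hy, hC' y hyC⟩ hxy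
    exact ⟨rfl, (hrel i x ⟨hx, hC' x hxC⟩ y ⟨hy, hC' y hyC⟩).1 hxy⟩

/-- `S` is the restriction of `R` to the Borel subset `Y` of its domain. -/
structure IsRestriction {X : Type} [MeasurableSpace X] (R S : CBER X) (Y : Set X) : Prop where
  sub : Y ⊆ R.dom
  dom : S.dom = Y
  rel : ∀ x y, S.rel x y ↔ R.rel x y ∧ x ∈ Y ∧ y ∈ Y

theorem CBER.isRestriction_restrict (R : CBER X) {Y : Set X} (hY : MeasurableSet Y)
    (hsub : Y ⊆ R.dom) : IsRestriction R (R.restrict Y hY) Y :=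
  ⟨hsub, Set.inter_eq_self_of_subset_right hsub, fun _ _ => Iff.rfl⟩

theorem IsRestriction.measurableSet {S : CBER X} {Y : Set X} (h : IsRestriction R S Y) :
    MeasurableSet Y := h.dom ▸ S.dom_meas

theorem IsRestriction.nullInvariant {S : CBER X} {Y : Set X} (h : IsRestriction R S Y)
    (hμ : R.NullInvariant μ) : S.NullInvariant (μ.restrict Y) := by
  intro N hN hN0
  rw [Measure.restrict_apply hN] at hN0
  refine nonpos_iff_eq_zero.1 ((Measure.restrict_apply_le _ _).trans ?_)
  refine (measure_mono ?_).trans (hμ _ (hN.inter h.measurableSet) hN0).le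
  rintro x ⟨y, hy, hxy⟩
  exact ⟨y, ⟨hy, ((h.rel x y).1 hxy).2.2⟩, ((h.rel x y).1 hxy).1⟩

end Trivialization

section Section

variable {X : Type} [MeasurableSpace X] [StandardBorelSpace X] {μ : Measure X} {R S : CBER X}
  {Y : Set X}

/-- Free indecomposability passes to complete sections. -/
theorem IsRestriction.freelyIndecomposableMod (h : IsRestriction R S Y) (hμ : R.NullInvariant μ)
    (hY : ∀ x ∈ R.dom, x ∈ R.hull Y) (hR : FreelyIndecomposableMod μ R) :
    FreelyIndecomposableMod (μ.restrict Y) S := by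
  intro ι _ Sf hS
  obtain ⟨r, hr, hrY, -, hrid⟩ := R.exists_selector h.measurableSet
  obtain ⟨f, hf, hfrel, hex⟩ := R.exists_enumeration
  have hrS : ∀ x y, R.rel x y → S.rel (r x) (r y) := by
    intro x y hxy
    have hx := hrY x (hY x (R.rel_dom hxy).1)
    have hy := hrY y (hY y (R.rel_dom hxy).2)
    exact (h.rel _ _).2 ⟨R.trans (R.symm hx.2) (R.trans hxy hy.2), hx.1, hy.1⟩
  let T : CBER X :=
    { dom := R.dom
      dom_meas := R.dom_meas
      rel := fun x y => R.rel x y ∧ r x = r y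
      rel_meas := R.rel_meas.inter
        (measurableSet_eq_fun (hr.comp measurable_fst) (hr.comp measurable_snd))
      rel_dom := fun h => R.rel_dom h.1
      refl := fun x hx => ⟨R.refl x hx, rfl⟩
      symm := fun h => ⟨R.symm h.1, h.2.symm⟩
      trans := fun h h' => ⟨R.trans h.1 h'.1, h.2.trans h'.2⟩
      countable_classes := fun x => (R.countable_classes x).mono fun y hy => hy.1 }
  have hT : ∀ x ∈ R.dom, T.rel x (r x) := fun x hx =>
    ⟨(hrY x (hY x hx)).2, (hrid _ (hrY x (hY x hx)).1).symm⟩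
  let Rf : Option ι → CBER X := fun k => k.elim T Sf
  have hsub : ∀ k x y, (Rf k).rel x y → R.rel x y := by
    rintro (_ | j) x y hxy
    · exact hxy.1
    · exact ((h.rel x y).1 (hS.rel_of hxy)).1
  have hfree : IsFreeProduct R Rf := by
    refine isFreeProduct_of_extends hsub (fun x hx => ⟨none, hx⟩) (fun x y hxy => ?_) ?_
    · have h1 : Relation.EqvGen (fun a b => ∃ i, (Rf i).rel a b) x (r x) :=
        .rel _ _ ⟨none, hT x (R.rel_dom hxy).1⟩
      have h2 : Relation.EqvGen (fun a b => ∃ i, (Rf i).rel a b) y (r y) :=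
        .rel _ _ ⟨none, hT y (R.rel_dom hxy).2⟩
      have h3 : Relation.EqvGen (fun a b => ∃ i, (Rf i).rel a b) (r x) (r y) :=
        eqvGen_map (g := id) (fun a b ⟨i, hi⟩ => .rel _ _ ⟨some i, hi⟩)
          ((hS.2.2 _ _).1 (hrS x y hxy)).2
      exact .trans _ _ _ h1 (.trans _ _ _ h3 (.symm _ _ h2))
    · intro G _ c hc
      have hcS : IsCocycleFamily Sf (fun i => c (some i)) := fun i x y z hxy hyz =>
        hc (some i) x y z hxy hyz
      obtain ⟨d, hd, hd'⟩ := hS.exists_extends hcS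
      have hcT : ∀ x y z, T.rel x y → T.rel y z → c none x y * c none y z = c none x z := hc none
      have hcT1 : ∀ x ∈ R.dom, c none x x = 1 := fun x hx =>
        hc.self (i := none) (show x ∈ (Rf none).dom from hx)
      have hd1 : ∀ x, S.rel x x → d x x = 1 := fun x hx => by simpa using hd x x x hx hx
      refine ⟨fun x y => c none x (r x) * d (r x) (r y) * c none (r y) y, ?_, ?_⟩
      · intro x y z hxy hyz
        have h1 : c none (r y) y * c none y (r y) = 1 := by
          have hy := hT y (R.rel_dom hxy).2
          rw [hcT _ _ _ (T.symm hy) hy, hcT1 _ (R.rel_dom hy.1).2]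
        simp only
        rw [← hd _ _ _ (hrS x y hxy) (hrS y z hyz)]
        calc _ = c none x (r x) * d (r x) (r y) * (c none (r y) y * c none y (r y)) *
            d (r y) (r z) * c none (r z) z := by group
          _ = _ := by rw [h1]; group
      · rintro (_ | j) x y hxy
        · have hxy' : T.rel x y := hxy
          have hx := hT x (R.rel_dom hxy'.1).1
          have h1 : T.rel (r x) y := T.trans (T.symm hx) hxy'
          simp only
          rw [← hxy'.2, hd1 _ (hrS x x (R.refl x (R.rel_dom hxy'.1).1)), mul_one,
            hcT _ _ _ hx h1]
        · have hxyS := hS.rel_of (show (Sf j).rel x y from hxy)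
          have hxy' := (h.rel x y).1 hxyS
          simp only
          rw [hrid x hxy'.2.1, hrid y hxy'.2.2, hcT1 _ (R.rel_dom hxy'.1).1,
            hcT1 _ (R.rel_dom hxy'.1).2, one_mul, mul_one]
          exact hd' j x y hxy
  obtain ⟨U, C, hU⟩ := (hR _ inferInstance Rf hfree).exists_isTrivializationOn hμ
  obtain ⟨D, hD, hDsub, hDdisj, hDcov, -⟩ :=
    exists_disjoint_refinement (fun i => (Sf i).dom_meas)
  let W : Set X := {y | y ∈ Y ∧ ∃ n, f n y ∈ U none ∧ r (f n y) = y}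
  have hWm : MeasurableSet W := by
    have : W = Y ∩ ⋃ n, (f n ⁻¹' U none ∩ {y | r (f n y) = y}) := by
      ext y
      simp [W]
    rw [this]
    exact h.measurableSet.inter (MeasurableSet.iUnion fun n => ((hf n) (hU.meas none)).inter
      (measurableSet_eq_fun (hr.comp (hf n)) measurable_id))
  have hW : ∀ y ∈ W, ∃ z ∈ U none, R.rel y z ∧ r z = y := fun y ⟨hy, n, hn, hn'⟩ =>
    ⟨f n y, hn, hfrel n y (h.sub hy), hn'⟩
  have hUself : ∀ k, ∀ x ∈ U k, x ∈ (Rf k).dom := fun k x hx => ((Rf k).rel_dom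
    (hU.rel k k x hx x hx (R.refl x (hU.base_sub (hU.sub k hx)))).2).1
  have hUS : ∀ j, ∀ x ∈ U (some j), x ∈ (Sf j).dom := fun j x hx => hUself (some j) x hx
  have hSY : ∀ j, ∀ x ∈ (Sf j).dom, x ∈ Y := fun j x hx =>
    ((h.rel x x).1 (hS.rel_of ((Sf j).refl x hx))).2.1
  refine IsTrivializationOn.inessentialMod (U := fun j => U (some j) ∪ (W ∩ D j)) (C := C ∩ Y)
    ⟨fun j => (hU.meas _).union (hWm.inter (hD j)), hU.meas_base.inter h.measurableSet,
      fun x hx => h.dom ▸ hx.2, ?_, ?_, ?_, ?_, ?_⟩ (fun j x y hxy => hS.rel_of hxy)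
  · refine nonpos_iff_eq_zero.1 ((Measure.restrict_apply_le _ _).trans ((measure_mono ?_).trans
      hU.null.le))
    rintro x ⟨hx, hx'⟩
    rw [h.dom] at hx
    exact ⟨h.sub hx, fun hC => hx' ⟨hC, hx⟩⟩
  · intro x y hx hxy
    have := (h.rel x y).1 hxy
    exact ⟨hU.invariant x y hx.1 this.1, this.2.2⟩
  · rintro j x (hx | hx)
    · exact ⟨hU.sub _ hx, hSY j x (hUS j x hx)⟩
    · obtain ⟨z, hz, hxz, -⟩ := hW x hx.1
      exact ⟨hU.invariant z x (hU.sub _ hz) (R.symm hxz), hx.1.1⟩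
  · rintro x ⟨hxC, hxY⟩
    obtain ⟨k, y, hy, hxy⟩ := hU.complete x hxC
    rcases k with _ | j
    · have hyr := hrY y (hY y (R.rel_dom hxy).2)
      obtain ⟨n, hn⟩ := hex _ _ (R.symm hyr.2)
      have hxr : S.rel x (r y) := (h.rel _ _).2 ⟨R.trans hxy hyr.2, hxY, hyr.1⟩
      obtain ⟨i, hi⟩ := Set.mem_iUnion.1 (hS.2.1 ▸ (S.rel_dom hxr).2)
      obtain ⟨j, hj⟩ := hDcov i _ hi
      exact ⟨j, r y, Or.inr ⟨⟨hyr.1, n, by rw [hn]; exact ⟨hy, rfl⟩⟩, hj⟩, hxr⟩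
    · exact ⟨j, y, Or.inl hy, (h.rel _ _).2 ⟨hxy, hxY, hSY j y (hUS j y hy)⟩⟩
  · rintro i j x hx y hy hxy
    have hxyR := ((h.rel x y).1 hxy).1
    rcases hx with hx | ⟨hx, hxi⟩ <;> rcases hy with hy | ⟨hy, hyj⟩
    · obtain ⟨h1, h2⟩ := hU.rel _ _ x hx y hy hxyR
      exact ⟨Option.some_injective _ h1, h2⟩
    · obtain ⟨z, hz, hyz, -⟩ := hW y hy
      exact absurd (hU.rel _ _ x hx z hz (R.trans hxyR hyz)).1 (by simp)
    · obtain ⟨z, hz, hxz, -⟩ := hW x hx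
      exact absurd (hU.rel _ _ z hz y hy (R.trans (R.symm hxz) hxyR)).1 (by simp)
    · obtain ⟨z, hz, hxz, hzx⟩ := hW x hx
      obtain ⟨w, hw, hyw, hwy⟩ := hW y hy
      have hzw : T.rel z w :=
        (hU.rel _ _ z hz w hw (R.trans (R.symm hxz) (R.trans hxyR hyw))).2
      have hxy' : x = y := by rw [← hzx, ← hwy, hzw.2]
      subst hxy'
      obtain rfl := hDdisj i j x hxi hyj
      exact ⟨rfl, (Sf i).refl x (hDsub i hxi)⟩

end Section

section Pieces

variable {X : Type} [MeasurableSpace X] [StandardBorelSpace X]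

/-- The subrelation of `Q` on the Borel set `W` of pairs not separated by the Borel map `t`. -/
def CBER.fibers (Q : CBER X) (W : Set X) (hW : MeasurableSet W) (t : X → X) (ht : Measurable t) :
    CBER X where
  dom := Q.dom ∩ W
  dom_meas := Q.dom_meas.inter hW
  rel x y := (Q.rel x y ∧ x ∈ W ∧ y ∈ W) ∧ t x = t y
  rel_meas := (Q.restrict W hW).rel_meas.inter
    (measurableSet_eq_fun (ht.comp measurable_fst) (ht.comp measurable_snd))
  rel_dom h := (Q.restrict W hW).rel_dom h.1
  refl x hx := ⟨(Q.restrict W hW).refl x hx, rfl⟩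
  symm h := ⟨(Q.restrict W hW).symm h.1, h.2.symm⟩
  trans h h' := ⟨(Q.restrict W hW).trans h.1 h'.1, h.2.trans h'.2⟩
  countable_classes x := (Q.countable_classes x).mono fun _ hy => hy.1.1

/-- A relation on whose classes `r` is injective is a free product of countably many relations on
whose domains `r` is injective. -/
theorem CBER.exists_isFreeProduct_injOn (Q : CBER X) {r : X → X} (hr : Measurable r)
    (hinj : ∀ x y, Q.rel x y → r x = r y → x = y) {f : ℕ → X → X} (hf : ∀ n, Measurable (f n))
    (hfr : ∀ x y, Q.rel x y → ∃ n, f n (r x) = y) :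
    ∃ P : (ℕ ⊕ (ℕ × ℕ × ℕ × Bool)) → CBER X, IsFreeProduct Q P ∧
      ∀ k, Set.InjOn r (P k).dom := by
  classical
  have hBm : ∀ n, MeasurableSet (Q.dom ∩ {z | f n (r z) = z}) := fun n =>
    Q.dom_meas.inter (measurableSet_eq_fun ((hf n).comp hr) measurable_id)
  let B : ℕ → Set X := fun n => Q.dom ∩ {z | f n (r z) = z}
  have hBinj : ∀ n, Set.InjOn r (B n) := fun n x hx y hy hxy => by
    rw [← hx.2, ← hy.2, hxy]
  have hBcov : ∀ x ∈ Q.dom, ∃ n, x ∈ B n := fun x hx => by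
    obtain ⟨n, hn⟩ := hfr x x (Q.refl x hx)
    exact ⟨n, hx, hn⟩
  obtain ⟨H, hHm, hHsub, hHdisj, hHcov, hHinv⟩ :=
    exists_disjoint_refinement (fun n => Q.measurableSet_hull (hBm n))
  have hHinv' : ∀ n x y, Q.rel x y → x ∈ H n → y ∈ H n := by
    intro n x y hxy hx
    refine hHinv x y (fun m => ⟨fun ⟨z, hz, h⟩ => ⟨z, hz, Q.trans (Q.symm hxy) h⟩,
      fun ⟨z, hz, h⟩ => ⟨z, hz, Q.trans hxy h⟩⟩) n hx
  have hHcov' : ∀ x ∈ Q.dom, ∃ n, x ∈ H n := fun x hx => by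
    obtain ⟨n, hn⟩ := hBcov x hx
    exact hHcov n x ⟨x, hn, Q.refl x hx⟩
  choose s hsm hsB _ hsid using fun n => Q.exists_selector (hBm n)
  obtain ⟨t, htm, ht⟩ := exists_measurable_piecewise H hHm s hsm (by
    intro i j hij x hx
    exact absurd (hHdisj i j x hx.1 hx.2) hij)
  let E : ℕ → Set X := fun n => B n ∩ H n
  have hEm : ∀ n, MeasurableSet (E n) := fun n => (hBm n).inter (hHm n)
  have htE : ∀ n, ∀ x ∈ H n, t x ∈ E n ∧ Q.rel x (t x) := fun n x hx => by
    have h1 := hsB n x (hHsub n hx)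
    rw [← ht n hx] at h1
    exact ⟨⟨h1.1, hHinv' n _ _ h1.2 hx⟩, h1.2⟩
  have htid : ∀ n, ∀ x ∈ E n, t x = x := fun n x hx => by
    rw [ht n hx.2, hsid n x hx.1]
  have htrel : ∀ x ∈ Q.dom, Q.rel x (t x) := fun x hx => by
    obtain ⟨n, hn⟩ := hHcov' x hx
    exact (htE n x hn).2
  have htt : ∀ x ∈ Q.dom, t (t x) = t x := fun x hx => by
    obtain ⟨n, hn⟩ := hHcov' x hx
    exact htid n _ (htE n x hn).1
  let Z : Set X := Q.dom \ ⋃ n, E n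
  have hZm : MeasurableSet Z := Q.dom_meas.diff (MeasurableSet.iUnion hEm)
  obtain ⟨A, hAm, hA⟩ := exists_seq_separating X MeasurableSet.empty Set.univ
  let F : ℕ × ℕ × ℕ × Bool → Set X := fun κ => Z ∩ ({z | f κ.1 (r z) = z} ∩
    {z | f κ.2.1 (r (t z)) = z} ∩
    {z | (r z ∈ A κ.2.2.1 ↔ κ.2.2.2 = true) ∧ (r (t z) ∈ A κ.2.2.1 ↔ ¬ κ.2.2.2 = true)})
  have hFm : ∀ κ, MeasurableSet (F κ) := by
    rintro ⟨n, l, k, b⟩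
    refine hZm.inter (((measurableSet_eq_fun ((hf n).comp hr) measurable_id).inter
      (measurableSet_eq_fun ((hf l).comp (hr.comp htm)) measurable_id)).inter ?_)
    have h1 : MeasurableSet {z | r z ∈ A k} := hr (hAm k)
    have h2 : MeasurableSet {z | r (t z) ∈ A k} := (hr.comp htm) (hAm k)
    cases b
    · convert h1.compl.inter h2 using 1
      ext z
      simp
    · convert h1.inter h2.compl using 1
      ext z
      simp
  obtain ⟨Z', hZ'm, hZ'sub, hZ'disj, hZ'cov, -⟩ := exists_disjoint_refinement hFm
  have hZ'Z : ∀ κ, Z' κ ⊆ Z := fun κ x hx => (hZ'sub κ hx).1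
  have hZcov : ∀ z ∈ Z, ∃ κ, z ∈ Z' κ := by
    intro z hz
    have hzt := htrel z hz.1
    obtain ⟨n, hn⟩ := hfr z z (Q.refl z hz.1)
    obtain ⟨l, hl⟩ := hfr (t z) z (Q.symm hzt)
    have hne : r z ≠ r (t z) := fun h => by
      have h1 := hinj _ _ hzt h
      obtain ⟨m, hm⟩ := hHcov' z hz.1
      exact hz.2 (Set.mem_iUnion.2 ⟨m, by rw [h1]; exact (htE m z hm).1⟩)
    have hk : ∃ k, ¬ (r z ∈ A k ↔ r (t z) ∈ A k) := by
      by_contra hcon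
      push Not at hcon
      exact hne (hA _ (Set.mem_univ _) _ (Set.mem_univ _) hcon)
    obtain ⟨k, hk⟩ := hk
    refine hZ'cov (n, l, k, decide (r z ∈ A k)) z ⟨hz, ⟨hn, hl⟩, ?_⟩
    simp only [decide_eq_true_eq]
    exact ⟨Iff.rfl, by tauto⟩
  have htinj : ∀ κ, Set.InjOn t (Z' κ) := fun κ x hx y hy hxy => by
    rw [← (hZ'sub κ hx).2.1.2, ← (hZ'sub κ hy).2.1.2, hxy]
  let W : ℕ × ℕ × ℕ × Bool → Set X := fun κ => Z' κ ∪ t '' Z' κ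
  have hWm : ∀ κ, MeasurableSet (W κ) := fun κ =>
    (hZ'm κ).union ((hZ'm κ).image_of_measurable_injOn htm (htinj κ))
  have hWinj : ∀ κ, Set.InjOn r (W κ) := by
    have hsep : ∀ κ, ∀ x ∈ Z' κ, ∀ y ∈ Z' κ, r x ≠ r (t y) := by
      intro κ x hx y hy h
      have h1 := (hZ'sub κ hx).2.2.1
      have h2 := (hZ'sub κ hy).2.2.2
      rw [h] at h1
      tauto
    rintro κ x (hx | ⟨x, hx, rfl⟩) y (hy | ⟨y, hy, rfl⟩) hxy
    · rw [← (hZ'sub κ hx).2.1.1, ← (hZ'sub κ hy).2.1.1, hxy]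
    · exact absurd hxy (hsep κ x hx y hy)
    · exact absurd hxy.symm (hsep κ y hy x hx)
    · rw [← (hZ'sub κ hx).2.1.2, ← (hZ'sub κ hy).2.1.2, hxy]
  let P : (ℕ ⊕ (ℕ × ℕ × ℕ × Bool)) → CBER X :=
    Sum.elim (fun n => Q.restrict (E n) (hEm n)) (fun κ => Q.fibers (W κ) (hWm κ) t htm)
  refine ⟨P, isFreeProduct_of_extends ?_ ?_ ?_ ?_, ?_⟩
  · rintro (n | κ) x y hxy
    · exact hxy.1
    · exact hxy.1.1
  · intro x hx
    by_cases hxZ : x ∈ Z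
    · obtain ⟨κ, hκ⟩ := hZcov x hxZ
      exact ⟨Sum.inr κ, hx, Or.inl hκ⟩
    · have : x ∈ ⋃ n, E n := by
        by_contra hcon
        exact hxZ ⟨hx, hcon⟩
      obtain ⟨n, hn⟩ := Set.mem_iUnion.1 this
      exact ⟨Sum.inl n, hx, hn⟩
  · have hstep : ∀ x ∈ Q.dom, Relation.EqvGen (fun a b => ∃ i, (P i).rel a b) x (t x) := by
      intro x hx
      by_cases hxZ : x ∈ Z
      · obtain ⟨κ, hκ⟩ := hZcov x hxZ
        exact .rel _ _ ⟨Sum.inr κ, ⟨htrel x hx, Or.inl hκ, Or.inr ⟨x, hκ, rfl⟩⟩, (htt x hx).symm⟩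
      · have : x ∈ ⋃ n, E n := by
          by_contra hcon
          exact hxZ ⟨hx, hcon⟩
        obtain ⟨n, hn⟩ := Set.mem_iUnion.1 this
        rw [htid n x hn]
        exact .refl _
    intro x y hxy
    obtain ⟨n, hn⟩ := hHcov' x (Q.rel_dom hxy).1
    have hx := htE n x hn
    have hy := htE n y (hHinv' n x y hxy hn)
    exact .trans _ _ _ (hstep x (Q.rel_dom hxy).1) (.trans _ _ _ (.rel _ _ ⟨Sum.inl n,
      Q.trans (Q.symm hx.2) (Q.trans hxy hy.2), hx.1, hy.1⟩)
      (.symm _ _ (hstep y (Q.rel_dom hxy).2)))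
  · intro G _ c hc
    have hmx : ∃ m : X → ℕ, ∀ x ∈ Q.dom, x ∈ H (m x) :=
      ⟨fun x => if h : x ∈ Q.dom then (hHcov' x h).choose else 0, fun x hx => by
        simp only [dif_pos hx]
        exact (hHcov' x hx).choose_spec⟩
    obtain ⟨m, hm⟩ := hmx
    have hm' : ∀ n, ∀ x ∈ H n, x ∈ Q.dom → m x = n := fun n x hx hxd =>
      hHdisj _ _ x (hm x hxd) hx
    let h : X → G := fun x => if hx : x ∈ Z then c (Sum.inr (hZcov x hx).choose) x (t x) else 1
    have hhZ : ∀ κ, ∀ x ∈ Z' κ, h x = c (Sum.inr κ) x (t x) := by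
      intro κ x hx
      have hxZ := hZ'Z κ hx
      simp only [h, dif_pos hxZ]
      rw [hZ'disj _ κ x (hZcov x hxZ).choose_spec hx]
    have hhE : ∀ n, ∀ x ∈ E n, h x = 1 := fun n x hx =>
      dif_neg fun hxZ => hxZ.2 (Set.mem_iUnion.2 ⟨n, hx⟩)
    refine ⟨fun x y => h x * c (Sum.inl (m x)) (t x) (t y) * (h y)⁻¹, ?_, ?_⟩
    · intro x y z hxy hyz
      have hx := hm x (Q.rel_dom hxy).1
      have hy := hHinv' _ _ _ hxy hx
      have hz := hHinv' _ _ _ hyz hy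
      have hmy := hm' _ y hy (Q.rel_dom hxy).2
      have hx' := htE _ _ hx
      have hy' := htE _ _ hy
      have hz' := htE _ _ hz
      simp only
      rw [hmy, ← hc (Sum.inl (m x)) (t x) (t y) (t z)
        ⟨Q.trans (Q.symm hx'.2) (Q.trans hxy hy'.2), hx'.1, hy'.1⟩
        ⟨Q.trans (Q.symm hy'.2) (Q.trans hyz hz'.2), hy'.1, hz'.1⟩]
      group
    · rintro (n | κ) x y hxy
      · have hx : x ∈ E n := hxy.2.1
        have hy : y ∈ E n := hxy.2.2
        simp only
        rw [hhE n x hx, hhE n y hy, htid n x hx, htid n y hy, hm' n x hx.2 hx.1.1]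
        simp
      · have hxd := (Q.rel_dom hxy.1.1).1
        have hyd := (Q.rel_dom hxy.1.1).2
        have hW : ∀ x ∈ W κ, x ∈ Q.dom → (P (Sum.inr κ)).rel x (t x) ∧
            h x = c (Sum.inr κ) x (t x) := by
          rintro x (hx | ⟨z, hz, rfl⟩) hxd
          · exact ⟨⟨⟨htrel x hxd, Or.inl hx, Or.inr ⟨x, hx, rfl⟩⟩, (htt x hxd).symm⟩, hhZ κ x hx⟩
          · have hzd := (hZ'Z κ hz).1
            obtain ⟨n, hn⟩ := hHcov' z hzd
            rw [htt z hzd]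
            have hd : t z ∈ (P (Sum.inr κ)).dom := ⟨hxd, Or.inr ⟨z, hz, rfl⟩⟩
            exact ⟨(P (Sum.inr κ)).refl _ hd, by rw [hhE n _ (htE n z hn).1, hc.self hd]⟩
        obtain ⟨hx1, hx2⟩ := hW x hxy.1.2.1 hxd
        obtain ⟨hy1, hy2⟩ := hW y hxy.1.2.2 hyd
        have h1 : c (Sum.inl (m x)) (t x) (t x) = 1 :=
          hc.self (i := Sum.inl (m x)) ⟨(Q.rel_dom hx1.1.1).2, (htE _ _ (hm x hxd)).1⟩
        have htxy : t x = t y := hxy.2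
        simp only
        rw [← htxy, h1, mul_one, hx2, hy2, mul_inv_eq_iff_eq_mul, hc _ _ _ _ hxy hy1, htxy]
  · rintro (n | κ)
    · exact (hBinj n).mono fun x hx => hx.2.1
    · exact (hWinj κ).mono fun x hx => hx.2

end Pieces

section Retraction

variable {X ι : Type} [MeasurableSpace X] [StandardBorelSpace X] [Countable ι] {R : CBER X}
  {Rf : ι → CBER X} {Y : Set X}

/-- A Borel retraction `r` onto a complete section of a free product which moves points along
idempotent Borel maps `p i` whose graphs are contained in the factors. -/
structure IsRetraction {X ι : Type} [MeasurableSpace X] (R : CBER X) (Rf : ι → CBER X)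
    (Y : Set X) (p : ι → X → X) (r : X → X) : Prop where
  meas : Measurable r
  meas_step : ∀ i, Measurable (p i)
  step_rel : ∀ i, ∀ x ∈ (Rf i).dom, (Rf i).rel x (p i x)
  step_idem : ∀ i, ∀ x ∈ (Rf i).dom, p i (p i x) = p i x
  step_eq : ∀ i, ∀ x ∈ Y, p i x = x
  mem : ∀ x ∈ R.dom, r x ∈ Y
  rel : ∀ x ∈ R.dom, R.rel x (r x)
  eq : ∀ x ∈ Y, r x = x
  comp_step : ∀ i, ∀ x ∈ (Rf i).dom, r (p i x) = r x
  cocycle : ∀ (G : Type) [Group G] (c : X → X → G),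
    (∀ x y z, R.rel x y → R.rel y z → c x y * c y z = c x z) →
    (∀ i, ∀ x ∈ (Rf i).dom, c x (p i x) = 1) → ∀ x ∈ R.dom, c x (r x) = 1

theorem IsFreeProduct.exists_isRetraction (hR : IsFreeProduct R Rf) (hYm : MeasurableSet Y)
    (hYd : Y ⊆ R.dom) (hY : ∀ x ∈ R.dom, x ∈ R.hull Y) : ∃ p r, IsRetraction R Rf Y p r := by
  classical
  let L : ℕ → Set X := fun n => Nat.rec Y (fun _ A => A ∪ ⋃ i, (Rf i).hull A) n
  have hLs : ∀ n, L (n + 1) = L n ∪ ⋃ i, (Rf i).hull (L n) := fun n => rfl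
  have hLm : ∀ n, MeasurableSet (L n) := by
    intro n
    induction n with
    | zero => exact hYm
    | succ n ih => exact ih.union (MeasurableSet.iUnion fun i => (Rf i).measurableSet_hull ih)
  have hLmono : Monotone L := monotone_nat_of_le_succ fun n => Set.subset_union_left
  have hLhull : ∀ n i x, x ∈ (Rf i).hull (L n) → x ∈ L (n + 1) := fun n i x hx =>
    Or.inr (Set.mem_iUnion.2 ⟨i, hx⟩)
  have hLd : ∀ n, L n ⊆ R.dom := by
    intro n
    induction n with
    | zero => exact hYd
    | succ n ih =>
      rintro x (hx | hx)
      · exact ih hx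
      · obtain ⟨i, y, hy, hxy⟩ := Set.mem_iUnion.1 hx
        exact (R.rel_dom (hR.rel_of hxy)).1
  have hLcov : ∀ x ∈ R.dom, ∃ n, x ∈ L n := by
    have key : ∀ x y, Relation.EqvGen (fun a b => ∃ i, (Rf i).rel a b) x y →
        ((∃ n, x ∈ L n) ↔ ∃ n, y ∈ L n) := by
      intro x y h
      induction h with
      | rel x y h =>
        obtain ⟨i, hi⟩ := h
        exact ⟨fun ⟨n, hn⟩ => ⟨n + 1, hLhull n i y ⟨x, hn, (Rf i).symm hi⟩⟩,
          fun ⟨n, hn⟩ => ⟨n + 1, hLhull n i x ⟨y, hn, hi⟩⟩⟩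
      | refl x => exact Iff.rfl
      | symm x y _ ih => exact ih.symm
      | trans x y z _ _ ih ih' => exact ih.trans ih'
    intro x hx
    obtain ⟨y, hy, hxy⟩ := hY x hx
    exact (key x y ((hR.2.2 x y).1 hxy).2).2 ⟨0, hy⟩
  obtain ⟨K, hKm, hKsub, hKdisj, hKcov, -⟩ := exists_disjoint_refinement
    (fun k : ℕ × ι => ((Rf k.2).measurableSet_hull (hLm k.1)).diff (hLm k.1))
  choose s hsm hsL _ hsid using fun k : ℕ × ι => (Rf k.2).exists_selector (hLm k.1)
  obtain ⟨q, hqm, hq⟩ := exists_measurable_piecewise (fun k : Option (ℕ × ι) => k.elim Y K)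
    (by rintro (_ | k); exacts [hYm, hKm k])
    (fun k : Option (ℕ × ι) => k.elim id s)
    (by rintro (_ | k); exacts [measurable_id, hsm k]) (by
      rintro (_ | k) (_ | l) hkl x ⟨hx, hx'⟩
      · exact absurd rfl hkl
      · exact absurd (hLmono (Nat.zero_le l.1) (show x ∈ L 0 from hx)) (hKsub l hx').2
      · exact absurd (hLmono (Nat.zero_le k.1) (show x ∈ L 0 from hx')) (hKsub k hx).2
      · exact absurd (congrArg some (hKdisj k l x hx hx')) hkl)
  have hqY : ∀ x ∈ Y, q x = x := fun x hx => hq none hx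
  have hqK : ∀ n i, ∀ x ∈ K (n, i), q x ∈ L n ∧ (Rf i).rel x (q x) := fun n i x hx => by
    rw [hq (some (n, i)) hx]
    exact hsL (n, i) x (hKsub _ hx).1
  have hLK : ∀ n, ∀ x ∈ L (n + 1), x ∉ L n → ∃ i, x ∈ K (n, i) := by
    intro n x hx hx'
    obtain ⟨i, hi⟩ := Set.mem_iUnion.1 (hx.resolve_left hx')
    obtain ⟨⟨m, j⟩, hj⟩ := hKcov (n, i) x ⟨hi, hx'⟩
    have h1 := hKsub _ hj
    have h2 : n ≤ m := by
      by_contra hlt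
      exact hx' (hLmono (show m + 1 ≤ n by omega) (hLhull m j x h1.1))
    have h3 : m ≤ n := by
      by_contra hlt
      exact h1.2 (hLmono (show n + 1 ≤ m by omega) hx)
    obtain rfl : n = m := le_antisymm h2 h3
    exact ⟨j, hj⟩
  have hqL : ∀ n, (∀ x ∈ L n, q x ∈ L n) ∧ ∀ x ∈ L (n + 1), q x ∈ L n := by
    intro n
    have main : ∀ n, (∀ x ∈ L n, q x ∈ L n) → ∀ x ∈ L (n + 1), q x ∈ L n := by
      intro n hn x hx
      rcases Classical.em (x ∈ L n) with hx' | hx'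
      · exact hn x hx'
      · obtain ⟨i, hi⟩ := hLK n x hx hx'
        exact (hqK n i x hi).1
    have h0 : ∀ n, ∀ x ∈ L n, q x ∈ L n := by
      intro n
      induction n with
      | zero => exact fun x hx => by rw [hqY x hx]; exact hx
      | succ n ih => exact fun x hx => hLmono (Nat.le_succ n) (main n ih x hx)
    exact ⟨h0 n, main n (h0 n)⟩
  have hqit : ∀ n, ∀ x ∈ L n, q^[n] x ∈ Y := by
    intro n
    induction n with
    | zero => exact fun x hx => hx
    | succ n ih =>
      intro x hx
      rw [Function.iterate_succ_apply]
      exact ih _ ((hqL n).2 x hx)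
  have hqadd : ∀ m n, m ≤ n → ∀ x ∈ L m, q^[n] x = q^[m] x := by
    intro m n hmn x hx
    obtain ⟨k, rfl⟩ := Nat.exists_eq_add_of_le hmn
    rw [add_comm, Function.iterate_add_apply]
    exact Function.iterate_fixed (hqY _ (hqit m x hx)) k
  obtain ⟨r, hrm, hr⟩ := exists_measurable_piecewise L hLm (fun n => q^[n])
    (fun n => hqm.iterate n) (by
      intro m n _ x hx
      rcases le_total m n with h | h
      · exact (hqadd m n h x hx.1).symm
      · exact hqadd n m h x hx.2)
  have hqrel : ∀ x ∈ R.dom, R.rel x (q x) ∧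
      (q x = x ∨ ∃ i n, x ∈ K (n, i)) := by
    intro x hx
    obtain ⟨n, hn⟩ := hLcov x hx
    induction n with
    | zero =>
      rw [hqY x hn]
      exact ⟨R.refl x hx, Or.inl rfl⟩
    | succ n ih =>
      rcases Classical.em (x ∈ L n) with h | h
      · exact ih h
      · obtain ⟨i, hi⟩ := hLK n x hn h
        exact ⟨hR.rel_of (hqK n i x hi).2, Or.inr ⟨i, n, hi⟩⟩
  have hrq : ∀ x ∈ R.dom, r (q x) = r x := by
    intro x hx
    obtain ⟨n, hn⟩ := hLcov x hx
    rw [hr n ((hqL n).1 x hn), hr (n + 1) (hLmono (Nat.le_succ n) hn),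
      Function.iterate_succ_apply]
  let N : ι → Set X := fun i => ⋃ n, K (n, i)
  have hNm : ∀ i, MeasurableSet (N i) := fun i => MeasurableSet.iUnion fun n => hKm (n, i)
  let p : ι → X → X := fun i => (N i).piecewise q id
  have hpN : ∀ i, ∀ x ∈ N i, p i x = q x := fun i x hx => Set.piecewise_eq_of_mem _ _ _ hx
  have hpN' : ∀ i, ∀ x ∉ N i, p i x = x := fun i x hx => Set.piecewise_eq_of_notMem _ _ _ hx
  refine ⟨p, r, hrm, fun i => hqm.piecewise (hNm i) measurable_id, ?_, ?_, ?_, ?_, ?_, ?_, ?_, ?_⟩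
  · intro i x hx
    by_cases hN : x ∈ N i
    · obtain ⟨n, hn⟩ := Set.mem_iUnion.1 hN
      rw [hpN i x hN]
      exact (hqK n i x hn).2
    · rw [hpN' i x hN]
      exact (Rf i).refl x hx
  · intro i x hx
    by_cases hN : x ∈ N i
    · obtain ⟨n, hn⟩ := Set.mem_iUnion.1 hN
      rw [hpN i x hN]
      refine hpN' i _ fun hN' => ?_
      obtain ⟨m, hm⟩ := Set.mem_iUnion.1 hN'
      obtain ⟨hqn, hxq⟩ := hqK n i x hn
      have hm' := hKsub _ hm
      have hmn : m < n := by
        by_contra hle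
        exact hm'.2 (hLmono (not_lt.1 hle) hqn)
      obtain ⟨z, hz, hqz⟩ := hm'.1
      exact (hKsub _ hn).2 (hLmono (show m + 1 ≤ n from hmn)
        (hLhull m i x ⟨z, hz, (Rf i).trans hxq hqz⟩))
    · rw [hpN' i x hN, hpN' i x hN]
  · intro i x hx
    refine hpN' i x fun hN => ?_
    obtain ⟨n, hn⟩ := Set.mem_iUnion.1 hN
    exact (hKsub _ hn).2 (hLmono (Nat.zero_le n) (show x ∈ L 0 from hx))
  · intro x hx
    obtain ⟨n, hn⟩ := hLcov x hx
    rw [hr n hn]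
    exact hqit n x hn
  · intro x hx
    obtain ⟨n, hn⟩ := hLcov x hx
    rw [hr n hn]
    clear hn
    induction n generalizing x with
    | zero => exact R.refl x hx
    | succ n ih =>
      rw [Function.iterate_succ_apply]
      have h1 := (hqrel x hx).1
      exact R.trans h1 (ih (q x) (R.rel_dom h1).2)
  · intro x hx
    exact hr 0 hx
  · intro i x hx
    by_cases hN : x ∈ N i
    · rw [hpN i x hN]
      exact hrq x (R.rel_dom (hR.rel_of ((Rf i).refl x hx))).1
    · rw [hpN' i x hN]
  · intro G _ c hc hcp x hx
    have hc1 : ∀ x ∈ R.dom, c x x = 1 := fun x hx => by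
      simpa using hc x x x (R.refl x hx) (R.refl x hx)
    have hcq : ∀ x ∈ R.dom, c x (q x) = 1 := by
      intro x hx
      rcases (hqrel x hx).2 with h | ⟨i, n, hn⟩
      · rw [h, hc1 x hx]
      · rw [← hpN i x (Set.mem_iUnion.2 ⟨n, hn⟩)]
        exact hcp i x ((Rf i).rel_dom (hqK n i x hn).2).1
    have key : ∀ n, ∀ x ∈ R.dom, R.rel x (q^[n] x) ∧ c x (q^[n] x) = 1 := by
      intro n
      induction n with
      | zero => exact fun x hx => ⟨R.refl x hx, hc1 x hx⟩
      | succ n ih =>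
        intro x hx
        rw [Function.iterate_succ_apply]
        have h1 := (hqrel x hx).1
        have h2 := ih (q x) (R.rel_dom h1).2
        exact ⟨R.trans h1 h2.1, by rw [← hc _ _ _ h1 h2.1, hcq x hx, h2.2, one_mul]⟩
    obtain ⟨n, hn⟩ := hLcov x hx
    rw [hr n hn]
    exact (key n x hx).2

end Retraction

section Section

variable {X : Type} [MeasurableSpace X] [StandardBorelSpace X] {μ : Measure X} {R S : CBER X}
  {Y : Set X}

/-- The image of a relation by a Borel map injective on its domain. -/
def CBER.image (P : CBER X) (r : X → X) (hr : Measurable r) (hinj : Set.InjOn r P.dom) :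
    CBER X where
  dom := r '' P.dom
  dom_meas := P.dom_meas.image_of_measurable_injOn hr hinj
  rel a b := ∃ x y, P.rel x y ∧ r x = a ∧ r y = b
  rel_meas := by
    have h : {q : X × X | ∃ x y, P.rel x y ∧ r x = q.1 ∧ r y = q.2} =
        Prod.map r r '' {q : X × X | P.rel q.1 q.2} := by
      ext ⟨a, b⟩
      simp
    rw [h]
    refine P.rel_meas.image_of_measurable_injOn (hr.prodMap hr) ?_
    rintro ⟨x, y⟩ hxy ⟨z, w⟩ hzw heq
    obtain ⟨h1, h2⟩ := Prod.ext_iff.1 heq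
    exact Prod.ext (hinj (P.rel_dom hxy).1 (P.rel_dom hzw).1 h1)
      (hinj (P.rel_dom hxy).2 (P.rel_dom hzw).2 h2)
  rel_dom := by
    rintro _ _ ⟨x, y, hxy, rfl, rfl⟩
    exact ⟨⟨x, (P.rel_dom hxy).1, rfl⟩, ⟨y, (P.rel_dom hxy).2, rfl⟩⟩
  refl := by
    rintro _ ⟨x, hx, rfl⟩
    exact ⟨x, x, P.refl x hx, rfl, rfl⟩
  symm := by
    rintro _ _ ⟨x, y, hxy, rfl, rfl⟩
    exact ⟨y, x, P.symm hxy, rfl, rfl⟩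
  trans := by
    rintro _ _ _ ⟨x, y, hxy, rfl, rfl⟩ ⟨y', z, hyz, hy, rfl⟩
    obtain rfl := hinj (P.rel_dom hyz).1 (P.rel_dom hxy).2 hy
    exact ⟨x, z, P.trans hxy hyz, rfl, rfl⟩
  countable_classes a := by
    by_cases ha : a ∈ r '' P.dom
    · obtain ⟨x, hx, rfl⟩ := ha
      refine ((P.countable_classes x).image r).mono ?_
      rintro _ ⟨x', y, hxy, hx', rfl⟩
      obtain rfl := hinj (P.rel_dom hxy).1 hx hx'
      exact ⟨y, hxy, rfl⟩
    · refine Set.countable_empty.mono ?_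
      rintro _ ⟨x, y, hxy, rfl, -⟩
      exact ha ⟨x, (P.rel_dom hxy).1, rfl⟩

/-- Free indecomposability of the restriction to a complete section implies free
indecomposability. -/
theorem IsRestriction.freelyIndecomposableMod_of_section (h : IsRestriction R S Y)
    (hμ : R.NullInvariant μ) (hY : ∀ x ∈ R.dom, x ∈ R.hull Y)
    (hS : FreelyIndecomposableMod (μ.restrict Y) S) : FreelyIndecomposableMod μ R := by
  classical
  intro ι _ Rf hR
  obtain ⟨p, r, hr⟩ := hR.exists_isRetraction h.measurableSet h.sub hY
  obtain ⟨f, hf, hfrel, hex⟩ := R.exists_enumeration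
  have hdom : ∀ i, ∀ x ∈ (Rf i).dom, x ∈ R.dom := fun i x hx =>
    (R.rel_dom (hR.rel_of ((Rf i).refl x hx))).1
  have hDm : ∀ i, MeasurableSet {z | p i z = z} := fun i =>
    measurableSet_eq_fun (hr.meas_step i) measurable_id
  let Q : ι → CBER X := fun i => (Rf i).restrict {z | p i z = z} (hDm i)
  have hQp : ∀ i x y, (Rf i).rel x y → (Q i).rel (p i x) (p i y) := by
    intro i x y hxy
    have hx := ((Rf i).rel_dom hxy).1
    have hy := ((Rf i).rel_dom hxy).2
    exact ⟨(Rf i).trans ((Rf i).symm (hr.step_rel i x hx))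
      ((Rf i).trans hxy (hr.step_rel i y hy)), hr.step_idem i x hx, hr.step_idem i y hy⟩
  have hrS : ∀ x y, R.rel x y → S.rel (r x) (r y) := fun x y hxy =>
    (h.rel _ _).2 ⟨R.trans (R.symm (hr.rel x (R.rel_dom hxy).1))
      (R.trans hxy (hr.rel y (R.rel_dom hxy).2)), hr.mem x (R.rel_dom hxy).1,
      hr.mem y (R.rel_dom hxy).2⟩
  have hcr : ∀ (G : Type) [Group G] (c : X → X → G),
      (∀ x y z, R.rel x y → R.rel y z → c x y * c y z = c x z) →
      (∀ i, ∀ x ∈ (Rf i).dom, c x (p i x) = 1) → ∀ x y, R.rel x y → c (r x) (r y) = c x y := by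
    intro G _ c hc hcp x y hxy
    have h1 := hr.rel x (R.rel_dom hxy).1
    have h2 := hr.rel y (R.rel_dom hxy).2
    have h3 := hc _ _ _ (R.trans h1 (R.trans (R.symm h1) hxy)) h2
    have h4 := hc _ _ _ h1 (R.trans (R.symm h1) (R.trans hxy h2))
    rw [hr.cocycle G c hc hcp y (R.rel_dom hxy).2, mul_one] at h3
    rw [hr.cocycle G c hc hcp x (R.rel_dom hxy).1, one_mul] at h4
    rw [h3, h4]
  have hQinj : ∀ i x y, (Q i).rel x y → r x = r y → x = y := by
    intro i x y hxy hrxy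
    obtain ⟨c, hc, hc'⟩ := hR.exists_extends
      (c := fun i x y => (FreeGroup.of (p i x))⁻¹ * FreeGroup.of (p i y))
      (fun i x y z _ _ => by group)
    beta_reduce at hc'
    have h1 := hcr _ c hc (fun i x hx => by
      rw [hc' i _ _ (hr.step_rel i x hx), hr.step_idem i x hx]
      group) x y (hR.rel_of hxy.1)
    have hx1 : R.rel (r x) (r x) := by
      have := hr.rel x (hdom i x ((Rf i).rel_dom hxy.1).1)
      exact R.trans (R.symm this) this
    have hx2 : c (r x) (r x) = 1 := by simpa using hc _ _ _ hx1 hx1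
    rw [← hrxy, hx2, hc' i _ _ hxy.1, hxy.2.1, hxy.2.2, eq_comm, inv_mul_eq_one] at h1
    exact FreeGroup.of_injective h1
  choose P hP hPinj using fun i => (Q i).exists_isFreeProduct_injOn hr.meas (hQinj i) hf
    (fun x y hxy => hex _ _ (R.trans (R.symm (hr.rel x (hdom i x ((Rf i).rel_dom hxy.1).1)))
      (hR.rel_of hxy.1)))
  have hPR : ∀ i k x y, (P i k).rel x y → (Rf i).rel x y := fun i k x y hxy =>
    ((hP i).rel_of hxy).1
  let Sf : ι × (ℕ ⊕ (ℕ × ℕ × ℕ × Bool)) → CBER X := fun k =>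
    (P k.1 k.2).image r hr.meas (hPinj k.1 k.2)
  have hsub : ∀ k x y, (Sf k).rel x y → S.rel x y := by
    rintro ⟨i, k⟩ _ _ ⟨x, y, hxy, rfl, rfl⟩
    exact hrS x y (hR.rel_of (hPR i k x y hxy))
  have hfree : IsFreeProduct S Sf := by
    refine isFreeProduct_of_extends hsub ?_ ?_ ?_
    · intro y hy
      rw [h.dom] at hy
      obtain ⟨i, hi⟩ := Set.mem_iUnion.1 (hR.2.1 ▸ h.sub hy)
      have hyQ : y ∈ (Q i).dom := ⟨hi, hr.step_eq i y hy⟩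
      rw [(hP i).2.1] at hyQ
      obtain ⟨k, hk⟩ := Set.mem_iUnion.1 hyQ
      exact ⟨(i, k), y, hk, hr.eq y hy⟩
    · intro x y hxy
      have hxy' := (h.rel x y).1 hxy
      rw [← hr.eq x hxy'.2.1, ← hr.eq y hxy'.2.2]
      refine eqvGen_map (g := r) ?_ ((hR.2.2 x y).1 hxy'.1).2
      rintro a b ⟨i, hab⟩
      rw [← hr.comp_step i a ((Rf i).rel_dom hab).1, ← hr.comp_step i b ((Rf i).rel_dom hab).2]
      refine eqvGen_map (g := r) ?_ (((hP i).2.2 _ _).1 (hQp i a b hab)).2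
      rintro z w ⟨k, hzw⟩
      exact .rel _ _ ⟨(i, k), z, w, hzw, rfl, rfl⟩
    · intro G _ c hc
      have hcP : ∀ i, IsCocycleFamily (P i) (fun k x y => c (i, k) (r x) (r y)) :=
        fun i k x y z hxy hyz => hc (i, k) _ _ _ ⟨x, y, hxy, rfl, rfl⟩ ⟨y, z, hyz, rfl, rfl⟩
      choose e he he' using fun i => (hP i).exists_extends (hcP i)
      obtain ⟨d, hd, hd'⟩ := hR.exists_extends (c := fun i x y => e i (p i x) (p i y))
        (fun i x y z hxy hyz => he i _ _ _ (hQp i x y hxy) (hQp i y z hyz))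
      beta_reduce at hd'
      refine ⟨d, fun x y z hxy hyz => hd x y z ((h.rel x y).1 hxy).1 ((h.rel y z).1 hyz).1, ?_⟩
      rintro ⟨i, k⟩ _ _ ⟨x, y, hxy, rfl, rfl⟩
      rw [hcr G d hd ?_ x y (hR.rel_of (hPR i k x y hxy)), hd' i x y (hPR i k x y hxy)]
      · have hQ := (hP i).rel_of hxy
        rw [hQ.2.1, hQ.2.2]
        exact he' i k x y hxy
      · intro j x hx
        rw [hd' j _ _ (hr.step_rel j x hx), hr.step_idem j x hx]
        have := hQp j x x ((Rf j).refl x hx)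
        simpa using he j _ _ _ this this
  obtain ⟨U, C, hU⟩ :=
    (hS _ inferInstance Sf hfree).exists_isTrivializationOn (h.nullInvariant hμ)
  have hCY : C ⊆ Y := h.dom ▸ hU.base_sub
  have hUr : ∀ k, ∀ w ∈ U k, ∃ z ∈ (P k.1 k.2).dom, r z = w := fun k w hw =>
    ((Sf k).rel_dom (hU.rel k k w hw w hw (S.refl w (hU.base_sub (hU.sub k hw)))).2).1
  have hPd : ∀ i k, ∀ x ∈ (P i k).dom, x ∈ R.dom := fun i k x hx =>
    hdom i x ((Rf i).rel_dom (hPR i k x x ((P i k).refl x hx))).1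
  refine IsTrivializationOn.inessentialMod
    (U := fun i => ⋃ k, ((P i k).dom ∩ r ⁻¹' U (i, k))) (C := R.hull C)
    ⟨fun i => MeasurableSet.iUnion fun k => (P i k).dom_meas.inter (hr.meas (hU.meas _)),
      R.measurableSet_hull hU.meas_base, ?_, ?_, ?_, ?_, ?_, ?_⟩ (fun i x y => hR.rel_of)
  · rintro x ⟨y, -, hxy⟩
    exact (R.rel_dom hxy).1
  · have h0 : μ (Y \ C) = 0 := by
      have := hU.null
      rw [h.dom, Measure.restrict_apply (h.measurableSet.diff hU.meas_base)] at this
      refine measure_mono_null ?_ this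
      intro x hx
      exact ⟨hx, hx.1⟩
    refine measure_mono_null ?_ (hμ _ (h.measurableSet.diff hU.meas_base) h0)
    rintro x ⟨hx, hxC⟩
    obtain ⟨y, hy, hxy⟩ := hY x hx
    exact ⟨y, ⟨hy, fun hyC => hxC ⟨y, hyC, hxy⟩⟩, hxy⟩
  · rintro x y ⟨z, hz, hxz⟩ hxy
    exact ⟨z, hz, R.trans (R.symm hxy) hxz⟩
  · rintro i x hx
    obtain ⟨k, hk, hkU⟩ := Set.mem_iUnion.1 hx
    exact ⟨r x, hU.sub _ hkU, hr.rel x (hPd i k x hk)⟩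
  · rintro x ⟨y, hy, hxy⟩
    obtain ⟨⟨i, k⟩, w, hw, hyw⟩ := hU.complete y hy
    obtain ⟨z, hz, rfl⟩ := hUr (i, k) w hw
    exact ⟨i, z, Set.mem_iUnion.2 ⟨k, hz, hw⟩,
      R.trans hxy (R.trans ((h.rel _ _).1 hyw).1 (R.symm (hr.rel z (hPd i k z hz))))⟩
  · rintro i j x hx y hy hxy
    obtain ⟨k, hk, hkU⟩ := Set.mem_iUnion.1 hx
    obtain ⟨l, hl, hlU⟩ := Set.mem_iUnion.1 hy
    obtain ⟨h1, a, b, hab, hax, hby⟩ := hU.rel _ _ _ hkU _ hlU (hrS x y hxy)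
    obtain ⟨rfl, rfl⟩ := Prod.ext_iff.1 h1
    obtain rfl := hPinj i k ((P i k).rel_dom hab).1 hk hax
    obtain rfl := hPinj i k ((P i k).rel_dom hab).2 hl hby
    exact ⟨rfl, hPR i k _ _ hab⟩

end Section

section Conull

variable {X : Type} [MeasurableSpace X] [StandardBorelSpace X] {μ : Measure X} {R S : CBER X}
  {H Y : Set X}

/-- Free indecomposability passes to conull invariant sets. -/
theorem IsRestriction.freelyIndecomposableMod_of_invariant (h : IsRestriction R S H)
    (hμ : R.NullInvariant μ) (hH : ∀ x y, x ∈ H → R.rel x y → y ∈ H)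
    (hR : FreelyIndecomposableMod μ R) : FreelyIndecomposableMod (μ.restrict H) S := by
  classical
  intro ι _ Sf hS
  let T : CBER X := R.restrict Hᶜ h.measurableSet.compl
  let Rf : Option ι → CBER X := fun k => k.elim T Sf
  have hsub : ∀ k x y, (Rf k).rel x y → R.rel x y := by
    rintro (_ | j) x y hxy
    · exact hxy.1
    · exact ((h.rel x y).1 (hS.rel_of hxy)).1
  have hSH : ∀ j x y, (Sf j).rel x y → x ∈ H := fun j x y hxy =>
    ((h.rel x y).1 (hS.rel_of hxy)).2.1
  have hfree : IsFreeProduct R Rf := by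
    refine isFreeProduct_of_extends hsub (fun x hx => ?_) (fun x y hxy => ?_) ?_
    · by_cases hxH : x ∈ H
      · rw [← h.dom, hS.2.1] at hxH
        obtain ⟨i, hi⟩ := Set.mem_iUnion.1 hxH
        exact ⟨some i, hi⟩
      · exact ⟨none, hx, hxH⟩
    · by_cases hxH : x ∈ H
      · exact eqvGen_map (g := id) (fun a b ⟨i, hi⟩ => .rel _ _ ⟨some i, hi⟩)
          ((hS.2.2 _ _).1 ((h.rel x y).2 ⟨hxy, hxH, hH x y hxH hxy⟩)).2
      · exact .rel _ _ ⟨none, hxy, hxH, fun hy => hxH (hH y x hy (R.symm hxy))⟩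
    · intro G _ c hc
      have hcS : IsCocycleFamily Sf (fun i => c (some i)) := fun i x y z hxy hyz =>
        hc (some i) x y z hxy hyz
      obtain ⟨d, hd, hd'⟩ := hS.exists_extends hcS
      refine ⟨fun x y => if x ∈ H then d x y else c none x y, fun x y z hxy hyz => ?_, ?_⟩
      · by_cases hx : x ∈ H
        · have hy := hH x y hx hxy
          simp only [hx, hy, if_true]
          exact hd _ _ _ ((h.rel x y).2 ⟨hxy, hx, hy⟩) ((h.rel y z).2 ⟨hyz, hy, hH y z hy hyz⟩)
        · have hy : y ∉ H := fun hy => hx (hH y x hy (R.symm hxy))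
          have hz : z ∉ H := fun hz => hy (hH z y hz (R.symm hyz))
          simp only [hx, hy, if_false]
          exact hc none x y z ⟨hxy, hx, hy⟩ ⟨hyz, hy, hz⟩
      · rintro (_ | j) x y hxy
        · exact if_neg hxy.2.1
        · exact (if_pos (hSH j x y hxy)).trans (hd' j x y hxy)
  obtain ⟨U, C, hU⟩ := (hR _ inferInstance Rf hfree).exists_isTrivializationOn hμ
  refine IsTrivializationOn.inessentialMod (U := fun j => U (some j) ∩ H) (C := C ∩ H)
    ⟨fun j => (hU.meas _).inter h.measurableSet, hU.meas_base.inter h.measurableSet,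
      fun x hx => h.dom ▸ hx.2, ?_, ?_, fun j x hx => ⟨hU.sub _ hx.1, hx.2⟩, ?_, ?_⟩
    (fun j x y hxy => hS.rel_of hxy)
  · refine nonpos_iff_eq_zero.1 ((Measure.restrict_apply_le _ _).trans ((measure_mono ?_).trans
      hU.null.le))
    rintro x ⟨hx, hx'⟩
    rw [h.dom] at hx
    exact ⟨h.sub hx, fun hC => hx' ⟨hC, hx⟩⟩
  · intro x y hx hxy
    have := (h.rel x y).1 hxy
    exact ⟨hU.invariant x y hx.1 this.1, this.2.2⟩
  · rintro x ⟨hxC, hxH⟩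
    obtain ⟨k, y, hy, hxy⟩ := hU.complete x hxC
    have hyH := hH x y hxH hxy
    rcases k with _ | j
    · have hyT : T.rel y y := (hU.rel none none y hy y hy (R.refl y (R.rel_dom hxy).2)).2
      exact absurd hyH hyT.2.1
    · exact ⟨j, y, ⟨hy, hyH⟩, (h.rel x y).2 ⟨hxy, hxH, hyH⟩⟩
  · rintro i j x hx y hy hxy
    obtain ⟨h1, h2⟩ := hU.rel _ _ x hx.1 y hy.1 ((h.rel x y).1 hxy).1
    exact ⟨Option.some_injective _ h1, h2⟩

/-- Free indecomposability can be checked on a conull invariant set. -/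
theorem IsRestriction.freelyIndecomposableMod_of_conull (h : IsRestriction R S H)
    (hμ : R.NullInvariant μ) (hH : ∀ x y, x ∈ H → R.rel x y → y ∈ H)
    (hH0 : μ (R.dom \ H) = 0) (hS : FreelyIndecomposableMod (μ.restrict H) S) :
    FreelyIndecomposableMod μ R := by
  classical
  intro ι _ Rf hR
  have hdomH : ∀ i x y, x ∈ H → (Rf i).rel x y → y ∈ H := fun i x y hx hxy =>
    hH x y hx (hR.rel_of hxy)
  let Sf : ι → CBER X := fun i => (Rf i).restrict H h.measurableSet
  have hgen : ∀ x y, Relation.EqvGen (fun a b => ∃ i, (Rf i).rel a b) x y →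
      (x ∈ H ↔ y ∈ H) ∧ (x ∈ H → Relation.EqvGen (fun a b => ∃ i, (Sf i).rel a b) x y) := by
    intro x y hxy
    induction hxy with
    | rel x y hxy =>
      obtain ⟨i, hi⟩ := hxy
      exact ⟨⟨fun hx => hdomH i x y hx hi, fun hy => hdomH i y x hy ((Rf i).symm hi)⟩,
        fun hx => .rel _ _ ⟨i, hi, hx, hdomH i x y hx hi⟩⟩
    | refl x => exact ⟨Iff.rfl, fun _ => .refl _⟩
    | symm x y _ ih => exact ⟨ih.1.symm, fun hy => .symm _ _ (ih.2 (ih.1.2 hy))⟩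
    | trans x y z _ _ ih ih' =>
      exact ⟨ih.1.trans ih'.1, fun hx => .trans _ _ _ (ih.2 hx) (ih'.2 (ih.1.1 hx))⟩
  have hfree : IsFreeProduct S Sf := by
    refine isFreeProduct_of_extends (fun i x y hxy => (h.rel x y).2 ⟨hR.rel_of hxy.1, hxy.2⟩)
      (fun x hx => ?_) (fun x y hxy => ?_) ?_
    · rw [h.dom] at hx
      obtain ⟨i, hi⟩ := Set.mem_iUnion.1 (hR.2.1 ▸ h.sub hx)
      exact ⟨i, hi, hx⟩
    · have hxy' := (h.rel x y).1 hxy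
      exact (hgen x y ((hR.2.2 x y).1 hxy'.1).2).2 hxy'.2.1
    · intro G _ c hc
      obtain ⟨d, hd, hd'⟩ :=
          hR.exists_extends (c := fun i x y => if x ∈ H then c i x y else 1) <| by
        intro i x y z hxy hyz
        by_cases hx : x ∈ H
        · have hy := hdomH i x y hx hxy
          simp only [hx, hy, if_true]
          exact hc i x y z ⟨hxy, hx, hy⟩ ⟨hyz, hy, hdomH i y z hy hyz⟩
        · have hy : y ∉ H := fun hy => hx (hdomH i y x hy ((Rf i).symm hxy))
          simp only [hx, hy, if_false, mul_one]
      refine ⟨d, fun x y z hxy hyz => hd x y z ((h.rel x y).1 hxy).1 ((h.rel y z).1 hyz).1, ?_⟩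
      exact fun i x y hxy => (hd' i x y hxy.1).trans (if_pos hxy.2.1)
  obtain ⟨U, C, hU⟩ :=
    (hS _ inferInstance Sf hfree).exists_isTrivializationOn (h.nullInvariant hμ)
  have hCH : C ⊆ H := h.dom ▸ hU.base_sub
  have hrelS : ∀ x y, x ∈ H → R.rel x y → S.rel x y := fun x y hx hxy =>
    (h.rel x y).2 ⟨hxy, hx, hH x y hx hxy⟩
  refine IsTrivializationOn.inessentialMod (U := U) (C := C)
    ⟨hU.meas, hU.meas_base, hCH.trans h.sub, ?_,
      fun x y hx hxy => hU.invariant x y hx (hrelS x y (hCH hx) hxy), hU.sub, ?_, ?_⟩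
    (fun j x y hxy => hR.rel_of hxy)
  · have h0 := hU.null
    rw [h.dom, Measure.restrict_apply (h.measurableSet.diff hU.meas_base)] at h0
    refine measure_mono_null ?_ (measure_union_null hH0 h0)
    rintro x ⟨hx, hxC⟩
    by_cases hxH : x ∈ H
    · exact Or.inr ⟨⟨hxH, hxC⟩, hxH⟩
    · exact Or.inl ⟨hx, hxH⟩
  · intro x hx
    obtain ⟨j, y, hy, hxy⟩ := hU.complete x hx
    exact ⟨j, y, hy, ((h.rel x y).1 hxy).1⟩
  · intro i j x hx y hy hxy
    obtain ⟨h1, h2⟩ := hU.rel i j x hx y hy (hrelS x y (hCH (hU.sub i hx)) hxy)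
    exact ⟨h1, h2.1⟩

/-- A relation is freely indecomposable if and only if its restriction to an almost everywhere
complete section is. -/
theorem IsRestriction.freelyIndecomposableMod_iff (h : IsRestriction R S Y)
    (hμ : R.NullInvariant μ) (hY : μ (R.dom \ R.hull Y) = 0) :
    FreelyIndecomposableMod μ R ↔ FreelyIndecomposableMod (μ.restrict Y) S := by
  have hHm := R.measurableSet_hull h.measurableSet
  have hHsub : R.hull Y ⊆ R.dom := fun x ⟨y, _, hxy⟩ => (R.rel_dom hxy).1
  have hinv : ∀ x y, x ∈ R.hull Y → R.rel x y → y ∈ R.hull Y := fun x y ⟨z, hz, hxz⟩ hxy =>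
    ⟨z, hz, R.trans (R.symm hxy) hxz⟩
  have hT := R.isRestriction_restrict hHm hHsub
  have hYH : Y ⊆ R.hull Y := fun y hy => ⟨y, hy, R.refl y (h.sub hy)⟩
  have hTS : IsRestriction (R.restrict (R.hull Y) hHm) S Y :=
    ⟨fun y hy => ⟨h.sub hy, hYH hy⟩, h.dom, fun x y => (h.rel x y).trans
      ⟨fun hxy => ⟨⟨hxy.1, hYH hxy.2.1, hYH hxy.2.2⟩, hxy.2⟩, fun hxy => ⟨hxy.1.1, hxy.2⟩⟩⟩
  have hTY : ∀ x ∈ (R.restrict (R.hull Y) hHm).dom, x ∈ (R.restrict (R.hull Y) hHm).hull Y := by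
    rintro x ⟨-, hx⟩
    obtain ⟨y, hy, hxy⟩ := id hx
    exact ⟨y, hy, hxy, hx, hYH hy⟩
  rw [← Measure.restrict_restrict_of_subset hYH]
  exact ⟨fun hR => hTS.freelyIndecomposableMod (hT.nullInvariant hμ) hTY
      (hT.freelyIndecomposableMod_of_invariant hμ hinv hR),
    fun hS => hT.freelyIndecomposableMod_of_conull hμ hinv hY
      (hTS.freelyIndecomposableMod_of_section (hT.nullInvariant hμ) hTY hS)⟩

end Conull

section Transfer

variable {X Y : Type} [MeasurableSpace X] [MeasurableSpace Y]

/-- The preimage on `D` of a relation by a Borel map injective on `D`. -/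
def CBER.comap (S : CBER Y) (φ : X → Y) (hφ : Measurable φ) (D : Set X) (hD : MeasurableSet D)
    (hinj : Set.InjOn φ D) : CBER X where
  dom := D ∩ φ ⁻¹' S.dom
  dom_meas := hD.inter (hφ S.dom_meas)
  rel x y := S.rel (φ x) (φ y) ∧ x ∈ D ∧ y ∈ D
  rel_meas := ((hφ.prodMap hφ) S.rel_meas).inter ((measurable_fst hD).inter (measurable_snd hD))
  rel_dom h := ⟨⟨h.2.1, (S.rel_dom h.1).1⟩, ⟨h.2.2, (S.rel_dom h.1).2⟩⟩
  refl _ hx := ⟨S.refl _ hx.2, hx.1, hx.1⟩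
  symm h := ⟨S.symm h.1, h.2.2, h.2.1⟩
  trans h h' := ⟨S.trans h.1 h'.1, h.2.1, h'.2.2⟩
  countable_classes x := Set.MapsTo.countable_of_injOn (t := {z | S.rel (φ x) z})
    (fun _ hy => hy.1) (hinj.mono fun _ hy => hy.2.2) (S.countable_classes (φ x))

/-- A Borel isomorphism of relations respecting null sets transfers free indecomposability. -/
theorem FreelyIndecomposableMod.transfer [StandardBorelSpace X] {μ : Measure X} {ν : Measure Y}
    {R : CBER X} {S : CBER Y} {φ : X → Y} {ψ : Y → X} (hR : FreelyIndecomposableMod μ R)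
    (hμ : R.NullInvariant μ) (hφ : Measurable φ) (hψ : Measurable ψ)
    (hφm : Set.MapsTo φ R.dom S.dom) (hψm : Set.MapsTo ψ S.dom R.dom)
    (hl : ∀ x ∈ R.dom, ψ (φ x) = x) (hr : ∀ y ∈ S.dom, φ (ψ y) = y)
    (hrel : ∀ x ∈ R.dom, ∀ y ∈ R.dom, (R.rel x y ↔ S.rel (φ x) (φ y)))
    (hnull : ∀ N ⊆ R.dom, MeasurableSet N → μ N = 0 → ν (S.dom ∩ ψ ⁻¹' N) = 0) :
    FreelyIndecomposableMod ν S := by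
  intro ι _ Sf hS
  have hinj : Set.InjOn φ R.dom := fun x hx y hy hxy => by rw [← hl x hx, ← hl y hy, hxy]
  have hψrel : ∀ a b, S.rel a b → R.rel (ψ a) (ψ b) := by
    intro a b hab
    have ha := (S.rel_dom hab).1
    have hb := (S.rel_dom hab).2
    rwa [hrel _ (hψm ha) _ (hψm hb), hr a ha, hr b hb]
  have hφrel : ∀ x y, R.rel x y → S.rel (φ x) (φ y) := fun x y hxy =>
    (hrel x (R.rel_dom hxy).1 y (R.rel_dom hxy).2).1 hxy
  let Rf : ι → CBER X := fun i => (Sf i).comap φ hφ R.dom R.dom_meas hinj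
  have hψf : ∀ i a b, (Sf i).rel a b → (Rf i).rel (ψ a) (ψ b) := by
    intro i a b hab
    have ha := (S.rel_dom (hS.rel_of hab)).1
    have hb := (S.rel_dom (hS.rel_of hab)).2
    refine ⟨?_, hψm ha, hψm hb⟩
    rwa [hr a ha, hr b hb]
  have hfree : IsFreeProduct R Rf := by
    refine isFreeProduct_of_extends
      (fun i x y hxy => (hrel x hxy.2.1 y hxy.2.2).2 (hS.rel_of hxy.1)) (fun x hx => ?_)
      (fun x y hxy => ?_) ?_
    · obtain ⟨i, hi⟩ := Set.mem_iUnion.1 (hS.2.1 ▸ hφm hx)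
      exact ⟨i, hx, hi⟩
    · rw [← hl x (R.rel_dom hxy).1, ← hl y (R.rel_dom hxy).2]
      exact eqvGen_map (g := ψ) (fun a b ⟨i, hi⟩ => .rel _ _ ⟨i, hψf i a b hi⟩)
        ((hS.2.2 _ _).1 (hφrel x y hxy)).2
    · intro G _ c hc
      obtain ⟨d, hd, hd'⟩ := hS.exists_extends (c := fun i a b => c i (ψ a) (ψ b))
        (fun i a b e hab hbe => hc i _ _ _ (hψf i a b hab) (hψf i b e hbe))
      refine ⟨fun x y => d (φ x) (φ y),
        fun x y z hxy hyz => hd _ _ _ (hφrel x y hxy) (hφrel y z hyz), fun i x y hxy => ?_⟩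
      beta_reduce at hd' ⊢
      rw [hd' i _ _ hxy.1, hl x hxy.2.1, hl y hxy.2.2]
  obtain ⟨U, C, hU⟩ := (hR _ inferInstance Rf hfree).exists_isTrivializationOn hμ
  refine IsTrivializationOn.inessentialMod (U := fun i => S.dom ∩ ψ ⁻¹' U i) (C := S.dom ∩ ψ ⁻¹' C)
    ⟨fun i => S.dom_meas.inter (hψ (hU.meas i)), S.dom_meas.inter (hψ hU.meas_base),
      fun y hy => hy.1, ?_,
      fun a b ha hab => ⟨(S.rel_dom hab).2, hU.invariant _ _ ha.2 (hψrel a b hab)⟩,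
      fun i y hy => ⟨hy.1, hU.sub i hy.2⟩, ?_, ?_⟩ (fun i x y hxy => hS.rel_of hxy)
  · refine measure_mono_null ?_ (hnull _ (fun x hx => hx.1) (R.dom_meas.diff hU.meas_base) hU.null)
    rintro y ⟨hy, hyC⟩
    exact ⟨hy, hψm hy, fun h => hyC ⟨hy, h⟩⟩
  · rintro a ⟨ha, haC⟩
    obtain ⟨i, y, hy, hay⟩ := hU.complete _ haC
    have hyd := (R.rel_dom hay).2
    refine ⟨i, φ y, ⟨hφm hyd, ?_⟩, ?_⟩
    · rwa [Set.mem_preimage, hl y hyd]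
    · have := hφrel _ _ hay
      rwa [hr a ha] at this
  · rintro i j a ⟨ha, hai⟩ b ⟨hb, hbj⟩ hab
    obtain ⟨h1, h2⟩ := hU.rel i j _ hai _ hbj (hψrel a b hab)
    have h3 := h2.1
    rw [hr a ha, hr b hb] at h3
    exact ⟨h1, h3⟩

end Transfer

/-- Removing a null set from an almost everywhere complete section leaves one. -/
theorem CBER.NullInvariant.null_diff_hull {X : Type} [MeasurableSpace X] {μ : Measure X}
    {R : CBER X} (hμ : R.NullInvariant μ) {A A' : Set X} (hA : MeasurableSet A)
    (hA' : MeasurableSet A') (h : ∀ᵐ x ∂μ, x ∈ R.dom → ∃ y ∈ A, R.rel x y)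
    (h0 : μ (A \ A') = 0) : μ (R.dom \ R.hull A') = 0 := by
  refine measure_mono_null ?_ (measure_union_null (ae_iff.1 h) (hμ _ (hA.diff hA') h0))
  rintro x ⟨hx, hxA⟩
  by_cases hex : ∃ y ∈ A, R.rel x y
  · obtain ⟨y, hy, hxy⟩ := hex
    exact Or.inr ⟨y, ⟨hy, fun hy' => hxA ⟨y, hy', hxy⟩⟩, hxy⟩
  · exact Or.inl fun h => hex (h hx)

theorem SOEquiv.image_eq {X Y : Type} [MeasurableSpace X] [MeasurableSpace Y] {R : CBER X}
    {μ : Measure X} {S : CBER Y} {ν : Measure Y} (E : SOEquiv R μ S ν) {N : Set X}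
    (hN : N ⊆ E.A) : E.toFun '' N = E.B ∩ E.invFun ⁻¹' N := by
  ext y
  constructor
  · rintro ⟨x, hx, rfl⟩
    refine ⟨E.mapsTo (hN hx), ?_⟩
    rwa [Set.mem_preimage, E.left_inv x (hN hx)]
  · rintro ⟨hy, hyN⟩
    exact ⟨E.invFun y, hyN, E.right_inv y hy⟩

/-- A stable orbit equivalence matches null sets. -/
theorem SOEquiv.measure_eq_zero_iff {X Y : Type} [MeasurableSpace X] [MeasurableSpace Y]
    {R : CBER X} {μ : Measure X} {S : CBER Y} {ν : Measure Y} [IsFiniteMeasure μ]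
    [IsFiniteMeasure ν] (E : SOEquiv R μ S ν) {N : Set X} (hN : N ⊆ E.A) (hNm : MeasurableSet N) :
    μ N = 0 ↔ ν (E.B ∩ E.invFun ⁻¹' N) = 0 := by
  have h := E.measure_eq N hN hNm
  rw [E.image_eq hN] at h
  have hA : (μ E.A)⁻¹ ≠ 0 := ENNReal.inv_ne_zero.2 (measure_ne_top μ _)
  have hB : (ν E.B)⁻¹ ≠ 0 := ENNReal.inv_ne_zero.2 (measure_ne_top ν _)
  constructor
  · intro h0
    rw [h0, mul_zero, eq_comm, mul_eq_zero] at h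
    exact h.resolve_left hB
  · intro h0
    rw [h0, mul_zero, mul_eq_zero] at h
    exact h.resolve_left hA

theorem SOEquiv.freelyIndecomposableMod_iff {X Y : Type} [MeasurableSpace X]
    [StandardBorelSpace X] [MeasurableSpace Y] [StandardBorelSpace Y] {R : CBER X} {μ : Measure X}
    {S : CBER Y} {ν : Measure Y} [IsFiniteMeasure μ] [IsFiniteMeasure ν] (E : SOEquiv R μ S ν)
    (hμ : R.NullInvariant μ) (hν : S.NullInvariant ν) :
    FreelyIndecomposableMod μ R ↔ FreelyIndecomposableMod ν S := by
  obtain ⟨C, hC, hC0, hCrel⟩ := E.rel_iff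
  have hAm : MeasurableSet (E.A ∩ C) := E.measA.inter hC
  have hBm : MeasurableSet (E.B ∩ E.invFun ⁻¹' (E.A ∩ C)) := E.measB.inter (E.meas_invFun hAm)
  have hA0 : μ (E.A \ (E.A ∩ C)) = 0 := by rwa [Set.sdiff_self_inter]
  have hB0 : ν (E.B \ (E.B ∩ E.invFun ⁻¹' (E.A ∩ C))) = 0 := by
    refine measure_mono_null ?_
      ((E.measure_eq_zero_iff (fun x hx => hx.1) (E.measA.diff hAm)).1 hA0)
    rintro y ⟨hy, hy'⟩
    exact ⟨hy, E.mapsTo_inv hy, fun h => hy' ⟨hy, h⟩⟩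
  have hAr := R.isRestriction_restrict hAm (fun x hx => E.A_sub hx.1)
  have hBr := S.isRestriction_restrict hBm (fun y hy => E.B_sub hy.1)
  rw [hAr.freelyIndecomposableMod_iff hμ (hμ.null_diff_hull E.measA hAm E.A_section hA0),
    hBr.freelyIndecomposableMod_iff hν (hν.null_diff_hull E.measB hBm E.B_section hB0)]
  have hto : Set.MapsTo E.toFun (E.A ∩ C) (E.B ∩ E.invFun ⁻¹' (E.A ∩ C)) := by
    intro x hx
    refine ⟨E.mapsTo hx.1, ?_⟩
    rwa [Set.mem_preimage, E.left_inv x hx.1]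
  constructor
  · intro h
    refine h.transfer (hAr.nullInvariant hμ) E.meas_toFun E.meas_invFun ?_ ?_ ?_ ?_ ?_ ?_
    · rw [hAr.dom, hBr.dom]
      exact hto
    · rw [hAr.dom, hBr.dom]
      exact fun y hy => hy.2
    · rw [hAr.dom]
      exact fun x hx => E.left_inv x hx.1
    · rw [hBr.dom]
      exact fun y hy => E.right_inv y hy.1
    · rw [hAr.dom]
      intro x hx y hy
      rw [hAr.rel, hBr.rel, hCrel x hx y hy]
      simp only [hx, hy, hto hx, hto hy, and_true]
    · rw [hAr.dom, hBr.dom]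
      intro N hN hNm hN0
      rw [Measure.restrict_apply hNm, Set.inter_eq_self_of_subset_left hN] at hN0
      refine nonpos_iff_eq_zero.1 ((Measure.restrict_apply_le _ _).trans ?_)
      refine (measure_mono ?_).trans
        ((E.measure_eq_zero_iff (hN.trans fun x hx => hx.1) hNm).1 hN0).le
      exact fun y hy => ⟨hy.1.1, hy.2⟩
  · intro h
    refine h.transfer (hBr.nullInvariant hν) E.meas_invFun E.meas_toFun ?_ ?_ ?_ ?_ ?_ ?_
    · rw [hAr.dom, hBr.dom]
      exact fun y hy => hy.2
    · rw [hAr.dom, hBr.dom]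
      exact hto
    · rw [hBr.dom]
      exact fun y hy => E.right_inv y hy.1
    · rw [hAr.dom]
      exact fun x hx => E.left_inv x hx.1
    · rw [hBr.dom]
      intro x hx y hy
      rw [hAr.rel, hBr.rel, hCrel _ hx.2 _ hy.2, E.right_inv x hx.1, E.right_inv y hy.1]
      simp only [hx, hy, show E.invFun x ∈ E.A ∩ C from hx.2, show E.invFun y ∈ E.A ∩ C from hy.2,
        and_true]
    · rw [hAr.dom, hBr.dom]
      intro N hN hNm hN0
      rw [Measure.restrict_apply hNm, Set.inter_eq_self_of_subset_left hN] at hN0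
      have hNm' : MeasurableSet ((E.A ∩ C) ∩ E.toFun ⁻¹' N) := hAm.inter (E.meas_toFun hNm)
      refine nonpos_iff_eq_zero.1 ((Measure.restrict_apply_le _ _).trans (le_of_eq ?_))
      refine (E.measure_eq_zero_iff (fun x hx => hx.1.1) hNm').2 (measure_mono_null ?_ hN0)
      rintro y ⟨hy, -, hy'⟩
      rwa [Set.mem_preimage, E.right_inv y hy] at hy'

/-- Free indecomposability is invariant under stable orbit equivalence;
in particular, for a non-null complete section `Y` of `R`, `R` is freely indecomposable
iff `R|Y` is. -/
theorem FI_SOE_invariant :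
    (∀ (X Y : Type) [MeasurableSpace X] [StandardBorelSpace X]
      [MeasurableSpace Y] [StandardBorelSpace Y]
      (μ : MeasureTheory.Measure X) [MeasureTheory.IsProbabilityMeasure μ]
      (ν : MeasureTheory.Measure Y) [MeasureTheory.IsProbabilityMeasure ν]
      (R : CBER X) (S : CBER Y), R.IsPMP μ → S.IsPMP ν → SOE R μ S ν →
        (FreelyIndecomposableMod μ R ↔ FreelyIndecomposableMod ν S)) ∧
    (∀ (X : Type) [MeasurableSpace X] [StandardBorelSpace X]
      (μ : MeasureTheory.Measure X) [MeasureTheory.IsProbabilityMeasure μ]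
      (R : CBER X) (Y : Set X) (hY : MeasurableSet Y),
      R.IsPMP μ → 0 < μ Y → R.IsCompleteSection Y →
        (FreelyIndecomposableMod μ R ↔
          FreelyIndecomposableMod (μ.restrict Y) (R.restrict Y hY))) := by
  refine ⟨fun X Y _ _ _ _ μ _ ν _ R S hR hS ⟨E⟩ =>
    E.freelyIndecomposableMod_iff hR.nullInvariant hS.nullInvariant,
    fun X _ _ μ _ R Y hY hR _ hsec =>
      (R.isRestriction_restrict hY hsec.2.1).freelyIndecomposableMod_iff hR.nullInvariant ?_⟩
  have hsub : R.dom ⊆ R.hull Y := fun x hx => hsec.2.2 x hx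
  rw [Set.sdiff_eq_empty.2 hsub, measure_empty]
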